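/- arXiv:1205.5774 — 4 statements merged into one kernel-verified Lean document; each statement's English description precedes it below -/
import Mathlib

section
/- Let ℓ be a nonnegative integer and let m ≥ d + ℓ + 2. Let f be a convex function on an open convex set Ω ⊂ R^d containing the origin with f(0) = 0 and ∇f(0) = 0, and suppose f is uniformly radially tame to order m on Ω with constant C₀. Then for every compactly supported ψ ∈ C^m(Ω) and every real λ ≠ 0, | ∫_Ω e^{iλf(x)} (f(x))^ℓ ψ(x) dx | ≤ C |λ|^{−ℓ} · Leb{ x ∈ Ω : |f(x)| < |λ|^{−1} } · sup_{x ∈ Ω} Σ_{k=0}^{m−1} |(x·∇)^k ψ(x)|, where C depends only on m, d, ℓ, and C₀, and Leb denotes Lebesgue measure. -/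
open Metric Set MeasureTheory
open scoped ENNReal

/-- The parameter interval of the ray from the origin in direction `v`
inside `Ω` (parametrized by arc length when `‖v‖ = 1`). -/
def raySet {d : ℕ} (Ω : Set (EuclideanSpace ℝ (Fin d)))
    (v : EuclideanSpace ℝ (Fin d)) : Set ℝ :=
  {t : ℝ | 0 ≤ t ∧ t • v ∈ Ω}

/-- `f` is uniformly radially tame to order `m` on `Ω` with constant `C`. -/
def UniformlyRadiallyTame {d : ℕ} (Ω : Set (EuclideanSpace ℝ (Fin d)))
    (f : EuclideanSpace ℝ (Fin d) → ℝ) (m : ℕ) (C : ℝ) : Prop :=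
  ∀ v : EuclideanSpace ℝ (Fin d), ‖v‖ = 1 →
    ContDiffOn ℝ (m : ℕ∞) (fun t : ℝ => f (t • v)) (raySet Ω v) ∧
    ∀ k : ℕ, 2 ≤ k → k ≤ m → ∀ t ∈ raySet Ω v,
      |f (t • v)| ^ (k - 1) *
          |iteratedDerivWithin k (fun s : ℝ => f (s • v)) (raySet Ω v) t| ≤
        C * |derivWithin (fun s : ℝ => f (s • v)) (raySet Ω v) t| ^ k

/-- The `k`-fold application of the radial differential operator `x·∇` to `ψ`,
with `(x·∇)^0 ψ = ψ`. -/
noncomputable def radialPow {d : ℕ} :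
    ℕ → (EuclideanSpace ℝ (Fin d) → ℝ) → EuclideanSpace ℝ (Fin d) → ℝ
  | 0, ψ => ψ
  | (k + 1), ψ => fun x => fderiv ℝ (radialPow k ψ) x x


/-- symbol classes along a ray -/
def SymCls (I : Set ℝ) (r : ℝ → ℝ) : ℕ → ℝ → (ℝ → ℝ) → (ℝ → ℝ) → Prop
  | 0, A, u, w => ContinuousOn u I ∧ ∀ t ∈ I, |u t| ≤ A * w t
  | (n + 1), A, u, w => (∀ t ∈ I, |u t| ≤ A * w t) ∧
      ∃ u' : ℝ → ℝ, (∀ t ∈ I, HasDerivAt u (u' t) t) ∧ SymCls I r n A u' (fun t => w t * r t)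

theorem SymCls.bd {I : Set ℝ} {r : ℝ → ℝ} {n : ℕ} {A : ℝ} {u w : ℝ → ℝ}
    (h : SymCls I r n A u w) : ∀ t ∈ I, |u t| ≤ A * w t := by
  cases n with
  | zero => exact h.2
  | succ n => exact h.1

theorem SymCls.cont {I : Set ℝ} {r : ℝ → ℝ} {n : ℕ} {A : ℝ} {u w : ℝ → ℝ}
    (h : SymCls I r n A u w) : ContinuousOn u I := by
  cases n with
  | zero => exact h.1
  | succ n =>
    obtain ⟨_, u', hu, _⟩ := h
    exact fun t ht => (hu t ht).continuousAt.continuousWithinAt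

theorem SymCls.mono {I : Set ℝ} {r : ℝ → ℝ} (hr : ∀ t ∈ I, 0 ≤ r t) {n : ℕ} :
    ∀ {A B : ℝ} {u w w' : ℝ → ℝ}, SymCls I r n A u w →
    (∀ t ∈ I, A * w t ≤ B * w' t) → SymCls I r n B u w' := by
  induction n with
  | zero => exact fun h hw => ⟨h.1, fun t ht => (h.2 t ht).trans (hw t ht)⟩
  | succ n ih =>
    rintro A B u w w' ⟨h, u', hu, hc⟩ hw
    refine ⟨fun t ht => (h t ht).trans (hw t ht), u', hu, ih hc ?_⟩
    intro t ht
    have := mul_le_mul_of_nonneg_right (hw t ht) (hr t ht)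
    simpa [mul_assoc] using this

theorem SymCls.pred {I : Set ℝ} {r : ℝ → ℝ} {n : ℕ} :
    ∀ {A : ℝ} {u w : ℝ → ℝ}, SymCls I r (n + 1) A u w → SymCls I r n A u w := by
  induction n with
  | zero => exact fun h => ⟨h.cont, h.bd⟩
  | succ n ih =>
    rintro A u w ⟨h, u', hu, hc⟩
    exact ⟨h, u', hu, ih hc⟩

theorem SymCls.add {I : Set ℝ} {r : ℝ → ℝ} {n : ℕ} :
    ∀ {A B : ℝ} {u v w : ℝ → ℝ}, SymCls I r n A u w → SymCls I r n B v w →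
    SymCls I r n (A + B) (fun t => u t + v t) w := by
  induction n with
  | zero =>
    intro A B u v w h k
    refine ⟨h.1.add k.1, fun t ht => ?_⟩
    have := abs_add_le (u t) (v t)
    nlinarith [h.2 t ht, k.2 t ht]
  | succ n ih =>
    rintro A B u v w ⟨h, u', hu, hc⟩ ⟨k, v', hv, kc⟩
    refine ⟨fun t ht => ?_, fun t => u' t + v' t, fun t ht => (hu t ht).add (hv t ht), ih hc kc⟩
    have := abs_add_le (u t) (v t)
    nlinarith [h t ht, k t ht]

theorem SymCls.neg {I : Set ℝ} {r : ℝ → ℝ} {n : ℕ} :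
    ∀ {A : ℝ} {u w : ℝ → ℝ}, SymCls I r n A u w →
    SymCls I r n A (fun t => - u t) w := by
  induction n with
  | zero =>
    intro A u w h
    exact ⟨h.1.neg, fun t ht => by simpa using h.2 t ht⟩
  | succ n ih =>
    rintro A u w ⟨h, u', hu, hc⟩
    exact ⟨fun t ht => by simpa using h t ht, fun t => - u' t, fun t ht => (hu t ht).neg, ih hc⟩

theorem SymCls.mul {I : Set ℝ} {r : ℝ → ℝ} (hr : ∀ t ∈ I, 0 ≤ r t) {n : ℕ} :
    ∀ {A B : ℝ} {u v w z : ℝ → ℝ}, SymCls I r n A u w → SymCls I r n B v z →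
    SymCls I r n (2 ^ n * A * B) (fun t => u t * v t) (fun t => w t * z t) := by
  have key : ∀ {A B : ℝ} {u v w z : ℝ → ℝ}, (∀ t ∈ I, |u t| ≤ A * w t) →
      (∀ t ∈ I, |v t| ≤ B * z t) → ∀ n : ℕ, ∀ t ∈ I, |u t * v t| ≤ 2 ^ n * A * B * (w t * z t) := by
    intro A B u v w z h k n t ht
    rw [abs_mul]
    have h1 := mul_le_mul (h t ht) (k t ht) (abs_nonneg _) ((abs_nonneg _).trans (h t ht))
    have h2 : 0 ≤ A * w t * (B * z t) :=
      mul_nonneg ((abs_nonneg _).trans (h t ht)) ((abs_nonneg _).trans (k t ht))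
    have h3 : (1 : ℝ) ≤ 2 ^ n := one_le_pow₀ (by norm_num)
    nlinarith
  induction n with
  | zero =>
    intro A B u v w z h k
    exact ⟨h.1.mul k.1, key h.2 k.2 0⟩
  | succ n ih =>
    intro A B u v w z h0 k0
    have h0' := h0.pred
    have k0' := k0.pred
    obtain ⟨h, u', hu, hc⟩ := h0
    obtain ⟨k, v', hv, kc⟩ := k0
    refine ⟨key h k _, fun t => u' t * v t + u t * v' t,
      fun t ht => (hu t ht).mul (hv t ht), ?_⟩
    have e1 := (ih hc k0').mono (B := 2 ^ n * A * B) (w' := fun t => w t * z t * r t) hr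
      (fun t ht => le_of_eq (by ring))
    have e2 := (ih h0' kc).mono (B := 2 ^ n * A * B) (w' := fun t => w t * z t * r t) hr
      (fun t ht => le_of_eq (by ring))
    exact (e1.add e2).mono hr (fun t ht => le_of_eq (by ring))

theorem SymCls.inv (n : ℕ) (A : ℝ) : ∃ B : ℝ, 0 ≤ B ∧ ∀ (I : Set ℝ) (r p : ℝ → ℝ),
    (∀ t ∈ I, 0 ≤ r t) → (∀ t ∈ I, 0 < p t) → SymCls I r n A p p →
    SymCls I r n B (fun t => (p t)⁻¹) (fun t => (p t)⁻¹) := by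
  induction n with
  | zero =>
    refine ⟨1, by norm_num, fun I r p hr hp h => ⟨h.1.inv₀ fun t ht => (hp t ht).ne', ?_⟩⟩
    intro t ht
    rw [abs_of_pos (inv_pos.2 (hp t ht)), one_mul]
  | succ n ih =>
    obtain ⟨B, hB, H⟩ := ih
    refine ⟨max 1 (2 ^ n * (2 ^ n * A * B) * B), by positivity, fun I r p hr hp h0 => ?_⟩
    have hI := H I r p hr hp h0.pred
    obtain ⟨h, p', hd, hc⟩ := h0
    refine ⟨fun t ht => ?_, fun t => -(p' t * (p t)⁻¹ * (p t)⁻¹), fun t ht => ?_, ?_⟩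
    · have := inv_pos.2 (hp t ht)
      rw [abs_of_pos this]
      nlinarith [le_max_left 1 (2 ^ n * (2 ^ n * A * B) * B)]
    · have e := (hd t ht).inv (hp t ht).ne'
      have e' : -p' t / p t ^ 2 = -(p' t * (p t)⁻¹ * (p t)⁻¹) := by
        rw [div_eq_mul_inv, pow_two, mul_inv]; ring
      rw [e'] at e
      exact e
    · have := ((hc.mul hr hI).mul hr hI).neg
      refine this.mono hr fun t ht => ?_
      have hp' := hp t ht
      have e : p t * r t * (p t)⁻¹ * (p t)⁻¹ = (p t)⁻¹ * r t := by field_simp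
      rw [e]
      exact mul_le_mul_of_nonneg_right (le_max_right _ _)
        (mul_nonneg (inv_pos.2 hp').le (hr t ht))

theorem SymCls.seq {I : Set ℝ} {r : ℝ → ℝ} {w : ℝ → ℝ} {G : ℕ → ℝ → ℝ} {m : ℕ} {B : ℝ}
    (hG : ∀ k < m, ∀ t ∈ I, HasDerivAt (G k) (G (k + 1) t) t)
    (hc : ∀ k ≤ m, ContinuousOn (G k) I)
    (hb : ∀ k ≤ m, ∀ t ∈ I, |G k t| ≤ B * (w t * r t ^ k)) (n : ℕ) :
    ∀ k, k + n ≤ m → SymCls I r n B (G k) (fun t => w t * r t ^ k) := by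
  induction n with
  | zero => exact fun k hk => ⟨hc k hk, hb k hk⟩
  | succ n ih =>
    intro k hk
    refine ⟨hb k (by omega), G (k + 1), hG k (by omega), ?_⟩
    have := ih (k + 1) (by omega)
    simpa [pow_succ, mul_assoc] using this

/-- class of the identity -/
theorem SymCls.ident {I : Set ℝ} {r : ℝ → ℝ} (hI : ∀ t ∈ I, 0 < t) (hr : ∀ t ∈ I, 1 ≤ t * r t)
    (hr0 : ∀ t ∈ I, 0 ≤ r t) (n : ℕ) : SymCls I r n 1 (fun t => t) (fun t => t) := by
  let G : ℕ → ℝ → ℝ := fun k => if k = 0 then fun t => t else if k = 1 then fun _ => 1 else fun _ => 0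
  have := SymCls.seq (I := I) (r := r) (w := fun t => t) (G := G) (m := n) (B := 1) ?_ ?_ ?_ n 0
    (by omega)
  · simpa [G] using this
  · intro k hk t ht
    match k with
    | 0 => simp only [G]; exact hasDerivAt_id t
    | 1 => simpa [G] using hasDerivAt_const t (1 : ℝ)
    | k + 2 => simpa [G] using hasDerivAt_const t (0 : ℝ)
  · intro k hk
    match k with
    | 0 => simp only [G]; exact continuousOn_id
    | 1 => simpa [G] using continuousOn_const
    | k + 2 => simpa [G] using continuousOn_const
  · intro k hk t ht
    match k with
    | 0 => simp [G, abs_of_pos (hI t ht)]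
    | 1 => simpa [G] using hr t ht
    | k + 2 =>
      have := hr0 t ht
      have := hI t ht
      simp [G]; positivity

theorem SymCls.pow (n : ℕ) (A : ℝ) (hA : 0 ≤ A) (l : ℕ) : ∃ B : ℝ, 0 ≤ B ∧
    ∀ (I : Set ℝ) (r p : ℝ → ℝ),
    (∀ t ∈ I, 0 ≤ r t) → (∀ t ∈ I, 0 < p t) → SymCls I r n A p p →
    SymCls I r n B (fun t => p t ^ l) (fun t => p t ^ l) := by
  induction l with
  | zero =>
    refine ⟨1, by norm_num, fun I r p hr hp h => ?_⟩
    simp only [pow_zero]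
    clear h
    have hz : ∀ n : ℕ, ∀ w : ℝ → ℝ, (∀ t ∈ I, 0 ≤ w t) → SymCls I r n 1 (fun _ => 0) w := by
      intro n
      induction n with
      | zero => exact fun w hw => ⟨continuousOn_const, fun t ht => by simpa using hw t ht⟩
      | succ n ih =>
        exact fun w hw => ⟨fun t ht => by simpa using hw t ht, fun _ => 0,
          fun t ht => hasDerivAt_const t (0 : ℝ), ih _ fun t ht => mul_nonneg (hw t ht) (hr t ht)⟩
    cases n with
    | zero => exact ⟨continuousOn_const, fun t ht => by simp⟩
    | succ n => exact ⟨fun t ht => by simp, fun _ => 0, fun t ht => hasDerivAt_const t (1 : ℝ),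
        hz _ _ fun t ht => by simpa using hr t ht⟩
  | succ l ih =>
    obtain ⟨B, hB, H⟩ := ih
    refine ⟨2 ^ n * B * A, by positivity, fun I r p hr hp h => ?_⟩
    simp only [pow_succ _ l]
    exact (H I r p hr hp h).mul hr h

/-- the radial derivatives of the amplitude -/
theorem SymCls.amp (n : ℕ) : ∃ B : ℝ, 0 ≤ B ∧
    ∀ (I : Set ℝ) (r : ℝ → ℝ) (φ : ℕ → ℝ → ℝ) (M : ℝ) (m k : ℕ), 0 ≤ M →
    (∀ t ∈ I, 0 < t) → (∀ t ∈ I, 1 ≤ t * r t) → (∀ t ∈ I, 0 ≤ r t) →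
    (∀ k < m, ContinuousOn (φ k) I) →
    (∀ k < m, ∀ t ∈ I, |φ k t| ≤ M) →
    (∀ k, k + 1 < m → ∀ t ∈ I, HasDerivAt (φ k) (φ (k + 1) t * t⁻¹) t) →
    k + n < m → SymCls I r n (B * M) (φ k) (fun _ => 1) := by
  induction n with
  | zero =>
    refine ⟨1, by norm_num, fun I r φ M m k hM hI h1 h2 hc hb hd hk => ⟨hc k hk, ?_⟩⟩
    simpa using hb k hk
  | succ n ih =>
    obtain ⟨B, hB, H⟩ := ih
    obtain ⟨D, hD, K⟩ := SymCls.inv n 1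
    refine ⟨max 1 (2 ^ n * B * D), by positivity, fun I r φ M m k hM hI h1 h2 hc hb hd hk => ?_⟩
    have e1 := H I r φ M m (k + 1) hM hI h1 h2 hc hb hd (by omega)
    have e2 := K I r _ h2 hI (SymCls.ident hI h1 h2 n)
    refine ⟨fun t ht => ?_, fun t => φ (k + 1) t * t⁻¹, hd k (by omega), ?_⟩
    · have := hb k (by omega) t ht
      nlinarith [le_max_left 1 (2 ^ n * B * D)]
    · refine (e1.mul h2 e2).mono h2 fun t ht => ?_
      have ht0 := hI t ht
      have : t⁻¹ ≤ r t := by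
        rw [inv_le_iff_one_le_mul₀ ht0]; linarith [h1 t ht]
      calc 2 ^ n * (B * M) * D * (1 * t⁻¹) = (2 ^ n * B * D * M) * t⁻¹ := by ring
        _ ≤ (max 1 (2 ^ n * B * D) * M) * (r t) := by
          gcongr
          exact le_max_right _ _
        _ = _ := by ring

theorem ibp_bound (n : ℕ) (Q : ℝ) (hQ : 0 ≤ Q) : ∃ K : ℝ, 0 ≤ K ∧
    ∀ (I : Set ℝ) (g g1 : ℝ → ℝ) (a b lam : ℝ), IsOpen I → Icc a b ⊆ I → a < b →
    (∀ t ∈ I, 0 < t) → (∀ t ∈ I, 0 < g t) → (∀ t ∈ I, 0 < g1 t) → (∀ t ∈ I, g t ≤ t * g1 t) →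
    (∀ t ∈ I, HasDerivAt g (g1 t) t) → ContinuousOn g1 I → lam ≠ 0 → g a = |lam|⁻¹ →
    SymCls I (fun t => g1 t / g t) n Q (fun t => (g1 t)⁻¹) (fun t => (g1 t)⁻¹) →
    ∀ (u w : ℝ → ℝ) (A : ℝ), 0 ≤ A → (∀ t ∈ I, 0 ≤ w t) → ContinuousOn w I →
    SymCls I (fun t => g1 t / g t) n A u w → (∀ᶠ t in nhds b, u t = 0) →
    ‖∫ t in a..b, Complex.exp (Complex.I * ((lam * g t : ℝ) : ℂ)) * (u t : ℂ)‖ ≤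
      K * A * (a * w a + ∫ t in a..b, w t * (g a / g t) ^ n) := by
  induction n with
  | zero =>
    refine ⟨1, by norm_num, ?_⟩
    intro I g g1 a b lam hIo hI hab ht0 hg0 hg10 hgt hgd hg1c hlam hga hq u w A hA hw hwc hu hub
    have haI : a ∈ I := hI (left_mem_Icc.2 hab.le)
    have h1 : ‖∫ t in a..b, Complex.exp (Complex.I * ((lam * g t : ℝ) : ℂ)) * (u t : ℂ)‖ ≤
        ∫ t in a..b, A * w t := by
      refine intervalIntegral.norm_integral_le_of_norm_le hab.le ?_ ?_
      · refine Filter.Eventually.of_forall fun t ht => ?_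
        rw [norm_mul, mul_comm Complex.I, Complex.norm_exp_ofReal_mul_I, one_mul,
          Complex.norm_real, Real.norm_eq_abs]
        exact hu.2 t (hI ⟨ht.1.le, ht.2⟩)
      · refine ContinuousOn.intervalIntegrable ?_
        rw [uIcc_of_le hab.le]
        exact (continuousOn_const.mul hwc).mono hI
    rw [intervalIntegral.integral_const_mul] at h1
    simp only [pow_zero, mul_one, one_mul]
    have : 0 ≤ A * (a * w a) := mul_nonneg hA (mul_nonneg (ht0 a haI).le (hw a haI))
    linarith
  | succ n ih =>
    obtain ⟨K, hK, H⟩ := ih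
    refine ⟨1 + K * (2 ^ (n + 1) * Q), by positivity, ?_⟩
    intro I g g1 a b lam hIo hI hab ht0 hg0 hg10 hgt hgd hg1c hlam hga hq u w A hA hw hwc hu hub
    have haI : a ∈ I := hI (left_mem_Icc.2 hab.le)
    have hbI : b ∈ I := hI (right_mem_Icc.2 hab.le)
    have hgc : ContinuousOn g I := fun t ht => (hgd t ht).continuousAt.continuousWithinAt
    have hr : ∀ t ∈ I, 0 ≤ g1 t / g t := fun t ht => (div_pos (hg10 t ht) (hg0 t ht)).le
    have huq := hu.mul hr hq
    have huqb := huq.bd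
    obtain ⟨hbd, v, hv, hvc⟩ := huq
    have hvc' : SymCls I (fun t => g1 t / g t) n (2 ^ (n + 1) * Q * A) v
        (fun t => w t * (g t)⁻¹) := by
      refine hvc.mono hr fun t ht => le_of_eq ?_
      have := hg0 t ht
      have := hg10 t ht
      field_simp
    have hvb : ∀ᶠ t in nhds b, v t = 0 := by
      filter_upwards [hub.eventually_nhds, hIo.mem_nhds hbI] with t ht htI
      have h0 : (fun t => u t * (g1 t)⁻¹) =ᶠ[nhds t] fun _ => (0 : ℝ) := by
        filter_upwards [ht] with s hs
        rw [hs, zero_mul]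
      exact (hv t htI).unique ((hasDerivAt_const t (0 : ℝ)).congr_of_eventuallyEq h0)
    have hw' : ∀ t ∈ I, 0 ≤ w t * (g t)⁻¹ := fun t ht =>
      mul_nonneg (hw t ht) (inv_pos.2 (hg0 t ht)).le
    have hwc' : ContinuousOn (fun t => w t * (g t)⁻¹) I :=
      hwc.mul (hgc.inv₀ fun t ht => (hg0 t ht).ne')
    have key := H I g g1 a b lam hIo hI hab ht0 hg0 hg10 hgt hgd hg1c hlam hga hq.pred v _
      (2 ^ (n + 1) * Q * A) (by positivity) hw' hwc' hvc' hvb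
    set V : ℝ → ℂ := fun t => Complex.exp (Complex.I * ((lam * g t : ℝ) : ℂ)) with hV
    have hVn : ∀ t, ‖V t‖ = 1 := fun t => by
      simp only [hV]
      rw [mul_comm Complex.I, Complex.norm_exp_ofReal_mul_I]
    have hVd : ∀ t ∈ I, HasDerivAt V (V t * (Complex.I * ((lam * g1 t : ℝ) : ℂ))) t := by
      intro t ht
      exact ((((hgd t ht).const_mul lam).ofReal_comp).const_mul Complex.I).cexp
    have hVc : ContinuousOn V I := fun t ht => (hVd t ht).continuousAt.continuousWithinAt
    have hU : uIcc a b = Icc a b := uIcc_of_le hab.le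
    have IBP := intervalIntegral.integral_mul_deriv_eq_deriv_mul (a := a) (b := b)
      (u := fun t => ((u t * (g1 t)⁻¹ : ℝ) : ℂ)) (u' := fun t => ((v t : ℝ) : ℂ))
      (v := V) (v' := fun t => V t * (Complex.I * ((lam * g1 t : ℝ) : ℂ)))
      (fun t ht => (hv t (hI (hU ▸ ht))).ofReal_comp)
      (fun t ht => hVd t (hI (hU ▸ ht)))
      (ContinuousOn.intervalIntegrable (by
        rw [hU]; exact Complex.continuous_ofReal.comp_continuousOn (hvc.cont.mono hI)))
      (ContinuousOn.intervalIntegrable (by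
        rw [hU]
        refine ContinuousOn.mono ?_ hI
        exact hVc.mul (continuousOn_const.mul
          (Complex.continuous_ofReal.comp_continuousOn (continuousOn_const.mul hg1c)))))
    have e1 : ∫ t in a..b, ((u t * (g1 t)⁻¹ : ℝ) : ℂ) * (V t * (Complex.I * ((lam * g1 t : ℝ) : ℂ)))
        = (Complex.I * lam) * ∫ t in a..b, V t * (u t : ℂ) := by
      rw [← intervalIntegral.integral_const_mul]
      refine intervalIntegral.integral_congr fun t ht => ?_
      have h1 : ((g1 t : ℝ) : ℂ) ≠ 0 := by
        exact_mod_cast (hg10 t (hI (hU ▸ ht))).ne'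
      push_cast
      field_simp
    have e2 : u b = 0 := hub.self_of_nhds
    rw [e1, e2] at IBP
    have e3 : ∫ t in a..b, ((v t : ℝ) : ℂ) * V t = ∫ t in a..b, V t * (v t : ℂ) := by
      simp only [mul_comm]
    rw [e3] at IBP
    have n1 := congrArg norm IBP
    rw [norm_mul, norm_mul, Complex.norm_I, one_mul, Complex.norm_real, Real.norm_eq_abs] at n1
    have hua : |u a * (g1 a)⁻¹| ≤ A * (w a * (a * (g a)⁻¹)) := by
      rw [abs_mul, abs_of_pos (inv_pos.2 (hg10 a haI)), ← mul_assoc]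
      have h1 : (g1 a)⁻¹ ≤ a * (g a)⁻¹ := by
        have := hgt a haI
        have h2 := hg0 a haI
        have h3 := hg10 a haI
        rw [← div_eq_mul_inv, le_div_iff₀ h2, inv_mul_le_iff₀ h3]
        linarith
      exact mul_le_mul (hu.bd a haI) h1 (inv_pos.2 (hg10 a haI)).le
        (mul_nonneg hA (hw a haI))
    have n2 : |lam| * ‖∫ t in a..b, V t * (u t : ℂ)‖ ≤ A * (w a * (a * (g a)⁻¹)) +
        ‖∫ t in a..b, V t * (v t : ℂ)‖ := by
      rw [n1]
      refine (norm_sub_le _ _).trans (add_le_add_left ?_ _)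
      simp only [zero_mul, Complex.ofReal_zero, zero_sub, norm_neg]
      rw [norm_mul, hVn, mul_one, Complex.norm_real, Real.norm_eq_abs]
      exact hua
    have hga0 := hg0 a haI
    have n3 : ‖∫ t in a..b, V t * (u t : ℂ)‖ ≤ g a * (A * (w a * (a * (g a)⁻¹)) +
        K * (2 ^ (n + 1) * Q * A) *
          (a * (w a * (g a)⁻¹) + ∫ t in a..b, w t * (g t)⁻¹ * (g a / g t) ^ n)) := by
      have : ‖∫ t in a..b, V t * (u t : ℂ)‖ =
          g a * (|lam| * ‖∫ t in a..b, V t * (u t : ℂ)‖) := by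
        rw [hga, ← mul_assoc, inv_mul_cancel₀ (abs_pos.2 hlam).ne', one_mul]
      rw [this]
      exact mul_le_mul_of_nonneg_left (n2.trans (by linarith)) hga0.le
    refine n3.trans ?_
    have e4 : ∫ t in a..b, w t * (g a / g t) ^ (n + 1) =
        g a * ∫ t in a..b, w t * (g t)⁻¹ * (g a / g t) ^ n := by
      rw [← intervalIntegral.integral_const_mul]
      refine intervalIntegral.integral_congr fun t ht => ?_
      simp only [pow_succ, div_eq_mul_inv]
      ring
    rw [e4]
    set J := ∫ t in a..b, w t * (g t)⁻¹ * (g a / g t) ^ n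
    have hJ : 0 ≤ J := by
      refine intervalIntegral.integral_nonneg hab.le fun t ht => ?_
      exact mul_nonneg (hw' t (hI ht)) (pow_nonneg (div_pos hga0 (hg0 t (hI ht))).le _)
    have e5 : g a * (A * (w a * (a * (g a)⁻¹)) +
        K * (2 ^ (n + 1) * Q * A) * (a * (w a * (g a)⁻¹) + J)) =
        A * (a * w a) + K * (2 ^ (n + 1) * Q) * A * (a * w a + g a * J) := by
      field_simp
    rw [e5]
    have : 0 ≤ A * (g a * J) := by positivity
    nlinarith

theorem osc_bound (p m ℓ : ℕ) (B0 : ℝ) (hB0 : 1 ≤ B0) (hm : p + 1 + ℓ + 2 ≤ m) : ∃ K : ℝ, 0 ≤ K ∧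
    ∀ (I : Set ℝ) (G φ : ℕ → ℝ → ℝ) (a b lam M : ℝ), IsOpen I → Icc a b ⊆ I → a < b →
    (∀ t ∈ I, 0 < t) → (∀ t ∈ I, 0 < G 0 t) → (∀ t ∈ I, G 0 t ≤ t * G 1 t) →
    (∀ k < m, ∀ t ∈ I, HasDerivAt (G k) (G (k + 1) t) t) →
    (∀ k ≤ m, ContinuousOn (G k) I) →
    (∀ k ≤ m, ∀ t ∈ I, |G k t| ≤ B0 * (G 0 t * (G 1 t / G 0 t) ^ k)) →
    lam ≠ 0 → G 0 a = |lam|⁻¹ → (∀ t ∈ Icc a b, t * G 0 a ≤ a * G 0 t) → 0 ≤ M →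
    (∀ k < m, ContinuousOn (φ k) I) →
    (∀ k < m, ∀ t ∈ I, |φ k t| ≤ M) →
    (∀ k, k + 1 < m → ∀ t ∈ I, HasDerivAt (φ k) (φ (k + 1) t * t⁻¹) t) →
    (∀ᶠ t in nhds b, φ 0 t = 0) →
    ‖∫ t in a..b, Complex.exp (Complex.I * ((lam * G 0 t : ℝ) : ℂ)) *
        ((G 0 t ^ ℓ * φ 0 t * t ^ p : ℝ) : ℂ)‖ ≤ K * M * (|lam|⁻¹ ^ ℓ * a ^ (p + 1)) := by
  obtain ⟨Q, hQ, HQ⟩ := SymCls.inv (ℓ + (p + 2)) B0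
  obtain ⟨K, hK, HK⟩ := ibp_bound (ℓ + (p + 2)) Q hQ
  obtain ⟨D, hD, HD⟩ := SymCls.amp (ℓ + (p + 2))
  obtain ⟨E, hE, HE⟩ := SymCls.pow (ℓ + (p + 2)) B0 (by linarith) ℓ
  obtain ⟨F, hF, HF⟩ := SymCls.pow (ℓ + (p + 2)) 1 (by norm_num) p
  refine ⟨K * (2 ^ (ℓ + (p + 2)) * (2 ^ (ℓ + (p + 2)) * E * D) * F) * 2, by positivity, ?_⟩
  intro I G φ a b lam M hIo hI hab ht0 hg0 hgt hGd hGc hGb hlam hga hlow hM hφc hφb hφd hφ0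
  have haI : a ∈ I := hI (left_mem_Icc.2 hab.le)
  have hg1 : ∀ t ∈ I, 0 < G 1 t := fun t ht => by
    have h1 := hgt t ht
    have h2 := hg0 t ht
    have h3 := ht0 t ht
    by_contra h
    nlinarith [not_lt.1 h]
  set r : ℝ → ℝ := fun t => G 1 t / G 0 t with hrdef
  have hr : ∀ t ∈ I, 0 ≤ r t := fun t ht => (div_pos (hg1 t ht) (hg0 t ht)).le
  have htr : ∀ t ∈ I, 1 ≤ t * r t := fun t ht => by
    simp only [hrdef]
    rw [← mul_div_assoc, le_div_iff₀ (hg0 t ht), one_mul]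
    exact hgt t ht
  have c0 : SymCls I r (ℓ + (p + 2)) B0 (G 0) (G 0) := by
    refine (SymCls.seq (m := m) hGd hGc hGb (ℓ + (p + 2)) 0 (by omega)).mono hr fun t ht => ?_
    simp
  have c1 : SymCls I r (ℓ + (p + 2)) B0 (G 1) (G 1) := by
    refine (SymCls.seq (m := m) hGd hGc hGb (ℓ + (p + 2)) 1 (by omega)).mono hr fun t ht => ?_
    have := (hg0 t ht).ne'
    simp only [pow_one]
    rw [mul_div_cancel₀ _ this]
  have q1 := HQ I r _ hr hg1 c1
  have gl := HE I r _ hr hg0 c0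
  have tp := HF I r _ hr ht0 (SymCls.ident ht0 htr hr _)
  have am := HD I r φ M m 0 hM ht0 htr hr hφc hφb hφd (by omega)
  have U := (gl.mul hr am).mul hr tp
  have U' : SymCls I r (ℓ + (p + 2))
      ((2 ^ (ℓ + (p + 2)) * (2 ^ (ℓ + (p + 2)) * E * D) * F) * M)
      (fun t => G 0 t ^ ℓ * φ 0 t * t ^ p) (fun t => G 0 t ^ ℓ * t ^ p) :=
    U.mono hr fun t ht => le_of_eq (by ring)
  have main := HK I (G 0) (G 1) a b lam hIo hI hab ht0 hg0 hg1 hgt (hGd 0 (by omega))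
    (hGc 1 (by omega)) hlam hga q1 _ _ _ (by positivity)
    (fun t ht => mul_nonneg (pow_nonneg (hg0 t ht).le _) (pow_nonneg (ht0 t ht).le _))
    (((hGc 0 (by omega)).pow _).mul (continuousOn_id.pow _)) U'
    (by filter_upwards [hφ0] with t ht; rw [ht]; ring)
  refine main.trans ?_
  have ha0 := ht0 a haI
  have hga0 := hg0 a haI
  have hJ : ∫ t in a..b, G 0 t ^ ℓ * t ^ p * (G 0 a / G 0 t) ^ (ℓ + (p + 2)) ≤
      G 0 a ^ ℓ * a ^ (p + 1) := by
    have hU : uIcc a b = Icc a b := uIcc_of_le hab.le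
    have h1 : ∫ t in a..b, G 0 t ^ ℓ * t ^ p * (G 0 a / G 0 t) ^ (ℓ + (p + 2)) ≤
        ∫ t in a..b, G 0 a ^ ℓ * a ^ (p + 2) * t ^ (-2 : ℤ) := by
      refine intervalIntegral.integral_mono_on hab.le ?_ ?_ ?_
      · refine ContinuousOn.intervalIntegrable ?_
        rw [hU]
        refine ContinuousOn.mono ?_ hI
        exact (((hGc 0 (by omega)).pow _).mul (continuousOn_id.pow _)).mul
          ((continuousOn_const.div (hGc 0 (by omega)) fun t ht => (hg0 t ht).ne').pow _)
      · refine ContinuousOn.intervalIntegrable ?_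
        rw [hU]
        refine ContinuousOn.mono ?_ hI
        exact continuousOn_const.mul (continuousOn_id.zpow₀ _ fun t ht => Or.inl (ht0 t ht).ne')
      · intro t ht
        have h2 := hg0 t (hI ht)
        have h3 := ht0 t (hI ht)
        have h4 : G 0 a / G 0 t ≤ a / t := by
          rw [div_le_div_iff₀ h2 h3]
          linarith [hlow t ht]
        have h5 : G 0 t ^ ℓ * t ^ p * (G 0 a / G 0 t) ^ (ℓ + (p + 2)) =
            G 0 a ^ ℓ * t ^ p * (G 0 a / G 0 t) ^ (p + 2) := by
          rw [pow_add _ ℓ, div_pow _ _ ℓ]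
          field_simp
        have h6 : G 0 a ^ ℓ * a ^ (p + 2) * t ^ (-2 : ℤ) = G 0 a ^ ℓ * t ^ p * (a / t) ^ (p + 2) := by
          rw [div_pow, zpow_neg, pow_add t p 2]
          norm_cast
          field_simp
        rw [h5, h6]
        have : 0 ≤ G 0 a / G 0 t := by positivity
        gcongr
    refine h1.trans ?_
    rw [intervalIntegral.integral_const_mul, integral_zpow]
    · have hb0 : 0 < b := ha0.trans hab
      have : (b ^ (-2 + 1 : ℤ) - a ^ (-2 + 1 : ℤ)) / (((-2 : ℤ) : ℝ) + 1) ≤ a⁻¹ := by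
        norm_num
        have := inv_pos.2 hb0
        rw [div_neg, div_one]
        linarith
      calc _ ≤ G 0 a ^ ℓ * a ^ (p + 2) * a⁻¹ := by gcongr
        _ = _ := by rw [pow_succ a (p + 1)]; field_simp
    · right
      refine ⟨by norm_num, ?_⟩
      rw [hU]
      exact fun h => absurd h.1 (not_le.2 ha0)
  have e : a * (G 0 a ^ ℓ * a ^ p) = G 0 a ^ ℓ * a ^ (p + 1) := by ring
  rw [e, ← hga]
  calc _ ≤ K * (2 ^ (ℓ + (p + 2)) * (2 ^ (ℓ + (p + 2)) * E * D) * F * M) *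
      (G 0 a ^ ℓ * a ^ (p + 1) + G 0 a ^ ℓ * a ^ (p + 1)) := by gcongr
    _ = _ := by ring

theorem radialPow_contDiff {d : ℕ} {ψ : EuclideanSpace ℝ (Fin d) → ℝ} (k : ℕ) :
    ∀ n : ℕ, ContDiff ℝ ((n + k : ℕ) : ℕ∞) ψ → ContDiff ℝ ((n : ℕ) : ℕ∞) (radialPow k ψ) := by
  induction k with
  | zero => intro n h; simpa [radialPow] using h
  | succ k ih =>
    intro n h
    have h1 := ih (n + 1) (by rw [show n + 1 + k = n + (k + 1) by ring]; exact h)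
    simp only [radialPow]
    refine ContDiff.clm_apply (h1.fderiv_right ?_) contDiff_id
    norm_cast

theorem radialPow_ray {d : ℕ} {ψ : EuclideanSpace ℝ (Fin d) → ℝ} {m : ℕ}
    (hψ : ContDiff ℝ (m : ℕ∞) ψ) (v : EuclideanSpace ℝ (Fin d)) (k : ℕ) (hk : k + 1 < m)
    (t : ℝ) (ht : 0 < t) :
    HasDerivAt (fun s : ℝ => radialPow k ψ (s • v)) (radialPow (k + 1) ψ (t • v) * t⁻¹) t := by
  have h1 : ContDiff ℝ ((m - k : ℕ) : ℕ∞) (radialPow k ψ) := by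
    apply radialPow_contDiff
    rw [Nat.sub_add_cancel (by omega)]; exact hψ
  have h2 : DifferentiableAt ℝ (radialPow k ψ) (t • v) := by
    refine (h1.differentiable ?_) _
    norm_cast
    omega
  have h3 : HasDerivAt (fun s : ℝ => s • v) v t := by
    simpa using (hasDerivAt_id t).smul_const v
  have h4 := h2.hasFDerivAt.comp_hasDerivAt t h3
  have h5 : radialPow (k + 1) ψ (t • v) * t⁻¹ = fderiv ℝ (radialPow k ψ) (t • v) v := by
    simp only [radialPow, map_smul, smul_eq_mul]
    field_simp
  rw [h5]
  exact h4

theorem radialPow_cont {d : ℕ} {ψ : EuclideanSpace ℝ (Fin d) → ℝ} {m : ℕ}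
    (hψ : ContDiff ℝ (m : ℕ∞) ψ) (k : ℕ) (hk : k < m) : Continuous (radialPow k ψ) := by
  have h1 : ContDiff ℝ ((m - k : ℕ) : ℕ∞) (radialPow k ψ) := by
    apply radialPow_contDiff
    rw [Nat.sub_add_cancel (by omega)]; exact hψ
  exact h1.continuous

theorem convex_nonneg {d : ℕ} {Ω : Set (EuclideanSpace ℝ (Fin d))}
    {f : EuclideanSpace ℝ (Fin d) → ℝ} (h0 : (0 : EuclideanSpace ℝ (Fin d)) ∈ Ω)
    (hf : ConvexOn ℝ Ω f) (hf0 : f 0 = 0)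
    (hd : HasFDerivAt f (0 : EuclideanSpace ℝ (Fin d) →L[ℝ] ℝ) 0) (x : EuclideanSpace ℝ (Fin d))
    (hx : x ∈ Ω) : 0 ≤ f x := by
  have hc : ConvexOn ℝ ((LinearMap.toSpanSingleton ℝ _ x) ⁻¹' Ω)
    (f ∘ (LinearMap.toSpanSingleton ℝ _ x)) := hf.comp_linearMap _
  have h3 : HasDerivAt (fun s : ℝ => s • x) x 0 := by
    simpa using (hasDerivAt_id (0 : ℝ)).smul_const x
  have hd' : HasFDerivAt f (0 : EuclideanSpace ℝ (Fin d) →L[ℝ] ℝ) ((0 : ℝ) • x) := by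
    simpa using hd
  have h4 := hd'.comp_hasDerivAt (0 : ℝ) h3
  have := hc.le_slope_of_hasDerivAt (x := 0) (y := 1) (f' := 0) (by simpa using h0)
    (by simpa using hx) one_pos h4
  simpa [slope_def_field, hf0] using this

theorem integral_volumeIoiPow (p : ℕ) (F : ℝ → ℂ) :
    ∫ t : Ioi (0 : ℝ), F t ∂(Measure.volumeIoiPow p) = ∫ t in Ioi (0 : ℝ), F t * ((t ^ p : ℝ) : ℂ) := by
  simp only [Measure.volumeIoiPow, ENNReal.ofReal]
  rw [integral_withDensity_eq_integral_smul,
    integral_subtype_comap measurableSet_Ioi fun a ↦ Real.toNNReal (a ^ p) • F a,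
    setIntegral_congr_fun measurableSet_Ioi fun x hx ↦ ?_]
  · rw [NNReal.smul_def, Real.coe_toNNReal _ (pow_nonneg hx.out.le _), mul_comm, Complex.real_smul]
  · exact (measurable_subtype_coe.pow_const _).real_toNNReal

theorem ray_bound (p m ℓ : ℕ) (C₀ : ℝ) (hm : p + 1 + ℓ + 2 ≤ m) : ∃ K : ℝ, 0 ≤ K ∧
    ∀ (d : ℕ) (Ω : Set (EuclideanSpace ℝ (Fin d))) (f : EuclideanSpace ℝ (Fin d) → ℝ),
        IsOpen Ω → Convex ℝ Ω → (0 : EuclideanSpace ℝ (Fin d)) ∈ Ω →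
        ConvexOn ℝ Ω f → f 0 = 0 →
        HasFDerivAt f (0 : EuclideanSpace ℝ (Fin d) →L[ℝ] ℝ) 0 →
        UniformlyRadiallyTame Ω f m C₀ →
        ∀ ψ : EuclideanSpace ℝ (Fin d) → ℝ,
          ContDiff ℝ (m : ℕ∞) ψ → HasCompactSupport ψ → tsupport ψ ⊆ Ω →
        ∀ lam : ℝ, lam ≠ 0 → ∀ M : ℝ, 0 ≤ M → (∀ k < m, ∀ x ∈ Ω, |radialPow k ψ x| ≤ M) →
        ∀ v : EuclideanSpace ℝ (Fin d), ‖v‖ = 1 →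
          ‖∫ t : Ioi (0 : ℝ), Complex.exp (Complex.I * ((lam * f ((t : ℝ) • v) : ℝ) : ℂ)) *
                ((f ((t : ℝ) • v) ^ ℓ * ψ ((t : ℝ) • v) : ℝ) : ℂ) ∂(Measure.volumeIoiPow p)‖ₑ ≤
            ENNReal.ofReal (K * M * |lam|⁻¹ ^ ℓ) *
              Measure.volumeIoiPow p
                {t : Ioi (0 : ℝ) | (t : ℝ) • v ∈ Ω ∧ |f ((t : ℝ) • v)| < |lam|⁻¹} := by
  obtain ⟨K, hK, HK⟩ := osc_bound p m ℓ (max 1 C₀) (le_max_left _ _) hm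
  refine ⟨(K + 1) * (p + 1), by positivity, ?_⟩
  intro d Ω f hΩ hΩc h0 hf hf0 hfd htame ψ hψ hψc hψΩ lam hlam M hM hMb v hv
  have hnn := convex_nonneg h0 hf hf0 hfd
  have hψ0 : ∀ x, x ∉ Ω → ψ x = 0 := fun x hx => by
    by_contra h
    exact hx (hψΩ (subset_tsupport _ h))
  have hψM : ∀ x, |ψ x| ≤ M := fun x => by
    by_cases hx : x ∈ Ω
    · exact hMb 0 (by omega) x hx
    · rw [hψ0 x hx, abs_zero]; exact hM
  have hc : 0 < |lam|⁻¹ := inv_pos.2 (abs_pos.2 hlam)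
  have hnorm : ∀ x, ‖Complex.exp (Complex.I * ((lam * f x : ℝ) : ℂ)) *
      ((f x ^ ℓ * ψ x : ℝ) : ℂ)‖ = |f x| ^ ℓ * |ψ x| := fun x => by
    rw [norm_mul, mul_comm Complex.I, Complex.norm_exp_ofReal_mul_I, one_mul,
          Complex.norm_real, Real.norm_eq_abs, abs_mul, abs_pow]
  have hsmall : ∀ x, x ∈ Ω → |f x| ≤ |lam|⁻¹ → |f x| ^ ℓ * |ψ x| ≤ |lam|⁻¹ ^ ℓ * M := by
    intro x hx hfx
    exact mul_le_mul (pow_le_pow_left₀ (abs_nonneg _) hfx _) (hψM x) (abs_nonneg _) (by positivity)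
  by_cases hcase : ∀ t : ℝ, 0 < t → t • v ∈ Ω → |f (t • v)| < |lam|⁻¹
  · refine (enorm_integral_le_lintegral_enorm _).trans ?_
    refine le_trans ?_ (lintegral_indicator_const_le _ _)
    refine lintegral_mono fun t => ?_
    by_cases ht : (t : ℝ) • v ∈ Ω
    · have ht2 := hcase t t.2 ht
      rw [indicator_of_mem (show t ∈ {t : Ioi (0 : ℝ) | (t : ℝ) • v ∈ Ω ∧
        |f ((t : ℝ) • v)| < |lam|⁻¹} from ⟨ht, ht2⟩), ← ofReal_norm, hnorm]
      refine ENNReal.ofReal_le_ofReal ((hsmall _ ht ht2.le).trans ?_)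
      have : (1 : ℝ) ≤ (K + 1) * (p + 1) := by
        have : (0 : ℝ) ≤ p := by positivity
        nlinarith
      have h2 : 0 ≤ |lam|⁻¹ ^ ℓ * M := by positivity
      nlinarith
    · simp [hψ0 _ ht]
  push Not at hcase
  obtain ⟨t0, ht0, ht0Ω, ht0c⟩ := hcase
  set S := raySet Ω v with hS
  set g : ℝ → ℝ := fun t => f (t • v) with hg
  obtain ⟨hsm, htm⟩ := htame v hv
  have hgnn : ∀ t, t • v ∈ Ω → 0 ≤ g t := fun t ht => hnn _ ht
  have hg00 : g 0 = 0 := by simp [hg, hf0]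
  have hstar : ∀ s t : ℝ, 0 ≤ s → s ≤ t → 0 < t → t • v ∈ Ω →
      s • v ∈ Ω ∧ t * g s ≤ s * g t := by
    intro s t hs hst ht htΩ
    have h1 : 0 ≤ s / t := by positivity
    have h2 : 0 ≤ 1 - s / t := by rw [sub_nonneg, div_le_one ht]; exact hst
    have e : (s / t) • (t • v) + (1 - s / t) • (0 : EuclideanSpace ℝ (Fin d)) = s • v := by
      rw [smul_zero, add_zero, smul_smul, div_mul_cancel₀ _ ht.ne']
    have h3 := hf.2 htΩ h0 h1 h2 (by ring)
    have h4 := hf.1 htΩ h0 h1 h2 (by ring)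
    rw [e] at h3 h4
    refine ⟨h4, ?_⟩
    simp only [hf0, smul_eq_mul, mul_zero, add_zero] at h3
    have : t * (s / t * f (t • v)) = s * f (t • v) := by field_simp
    calc t * g s ≤ t * (s / t * f (t • v)) := mul_le_mul_of_nonneg_left h3 ht.le
      _ = _ := this
  have hgcS : ContinuousOn g S := hsm.continuousOn
  -- the level point
  obtain ⟨a, ha, hga⟩ : ∃ a ∈ Icc 0 t0, g a = |lam|⁻¹ := by
    have hsub : Icc 0 t0 ⊆ S := fun s hs => ⟨hs.1, (hstar s t0 hs.1 hs.2 ht0 ht0Ω).1⟩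
    have := intermediate_value_Icc ht0.le (hgcS.mono hsub)
    refine this ⟨by rw [hg00]; exact hc.le, ?_⟩
    rw [abs_of_nonneg (hnn _ ht0Ω)] at ht0c
    exact ht0c
  have ha0 : 0 < a := by
    rcases ha.1.eq_or_lt with h | h
    · rw [← h, hg00] at hga; linarith
    · exact h
  have haΩ : a • v ∈ Ω := (hstar a t0 ha.1 ha.2 ht0 ht0Ω).1
  -- the right end
  have hopen : IsOpen {t : ℝ | t • v ∈ Ω} := hΩ.preimage (by fun_prop)
  obtain ⟨b0, hb0Ω, hab0, hb0⟩ : ∃ b0 : ℝ, b0 • v ∈ Ω ∧ a ≤ b0 ∧ ∀ t, b0 < t → ψ (t • v) = 0 := by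
    have hcpt : IsCompact ({t : ℝ | 0 ≤ t ∧ t • v ∈ tsupport ψ} ∪ {a}) := by
      refine IsCompact.union ?_ isCompact_singleton
      refine Metric.isCompact_of_isClosed_isBounded ?_ ?_
      · exact isClosed_Ici.inter ((isClosed_tsupport ψ).preimage (by fun_prop))
      · obtain ⟨R, hR⟩ := hψc.isBounded.exists_norm_le
        refine (Metric.isBounded_closedBall (x := (0 : ℝ)) (r := R)).subset fun t ht => ?_
        have := hR _ ht.2
        rw [norm_smul, hv, mul_one] at this
        simpa using this
    obtain ⟨b0, hb0m, hb0⟩ := hcpt.exists_isGreatest ⟨a, Or.inr rfl⟩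
    have hab0 : a ≤ b0 := hb0 (Or.inr rfl)
    refine ⟨b0, ?_, hab0, fun t ht => ?_⟩
    · rcases hb0m with h | h
      · exact hψΩ h.2
      · rw [h]; exact haΩ
    · by_contra h
      have := hb0 (Or.inl ⟨(ha0.le.trans hab0).trans ht.le, subset_tsupport _ h⟩)
      linarith
  obtain ⟨b, hb0b, hbΩ⟩ : ∃ b, b0 < b ∧ b • v ∈ Ω := by
    have h1 : ∀ᶠ t in nhdsWithin b0 (Ioi b0), t • v ∈ Ω :=
      nhdsWithin_le_nhds (hopen.mem_nhds hb0Ω)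
    obtain ⟨b, h2, h3⟩ := (h1.and self_mem_nhdsWithin).exists
    exact ⟨b, h3, h2⟩
  have hab : a < b := hab0.trans_lt hb0b
  have hbpos : 0 < b := ha0.trans hab
  have hsubS : Icc 0 b ⊆ S := fun s hs => ⟨hs.1, (hstar s b hs.1 hs.2 hbpos hbΩ).1⟩
  -- the slice
  have hslice : {t : Ioi (0 : ℝ) | (t : ℝ) • v ∈ Ω ∧ |f ((t : ℝ) • v)| < |lam|⁻¹} =
      Iio ⟨a, ha0⟩ := by
    ext t
    have htp : 0 < (t : ℝ) := t.2
    simp only [mem_ofPred_eq, mem_Iio]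
    rw [← Subtype.coe_lt_coe]
    constructor
    · rintro ⟨h1, h2⟩
      by_contra h
      have h3 := (hstar a t ha0.le (not_lt.1 h) htp h1).2
      rw [abs_of_nonneg (hnn _ h1)] at h2
      have h4 : g t < |lam|⁻¹ := h2
      rw [hga] at h3
      have h5 : a ≤ t := not_lt.1 h
      nlinarith
    · intro h
      have h' : (t : ℝ) < a := h
      obtain ⟨h1, h3⟩ := hstar t a htp.le h'.le ha0 haΩ
      refine ⟨h1, ?_⟩
      rw [abs_of_nonneg (hnn _ h1)]
      change g t < _
      rw [hga] at h3
      have : a * g t < a * |lam|⁻¹ := h3.trans_lt (by gcongr)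
      exact lt_of_mul_lt_mul_left this ha0.le
  rw [hslice, Measure.volumeIoiPow_apply_Iio]
  -- the oscillatory part
  set I : Set ℝ := {t : ℝ | 0 < t ∧ t • v ∈ Ω ∧ 0 < g t} with hIdef
  have hSo : {t : ℝ | 0 < t ∧ t • v ∈ Ω} ⊆ S := fun t ht => ⟨ht.1.le, ht.2⟩
  have hoo : IsOpen {t : ℝ | 0 < t ∧ t • v ∈ Ω} := isOpen_Ioi.inter hopen
  have hIo : IsOpen I := by
    have := (hgcS.mono hSo).isOpen_inter_preimage hoo (isOpen_Ioi (a := (0 : ℝ)))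
    convert this using 1
    ext t
    simp [hIdef, and_assoc]
  have hIS : I ⊆ S := fun t ht => ⟨ht.1.le, ht.2.1⟩
  have hnhds : ∀ t ∈ I, S ∈ nhds t := fun t ht =>
    Filter.mem_of_superset (hIo.mem_nhds ht) hIS
  have hSconv : Convex ℝ S := by
    intro x hx y hy α β hα hβ hαβ
    refine ⟨?_, ?_⟩
    · have := hx.1
      have := hy.1
      simp only [smul_eq_mul]; positivity
    · have := hΩc hx.2 hy.2 hα hβ hαβ
      convert this using 1
      simp only [smul_eq_mul, add_smul, mul_smul]
  have hgconv : ConvexOn ℝ S g := by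
    refine ⟨hSconv, ?_⟩
    intro x hx y hy α β hα hβ hαβ
    have := hf.2 hx.2 hy.2 hα hβ hαβ
    simp only [hg]
    convert this using 2
    simp only [smul_eq_mul, add_smul, mul_smul]
  have hIab : Icc a b ⊆ I := by
    intro t ht
    have ht0 : 0 < t := ha0.trans_le ht.1
    have h1 := (hstar t b ht0.le ht.2 hbpos hbΩ).1
    refine ⟨ht0, h1, ?_⟩
    have h2 := (hstar a t ha0.le ht.1 ht0 h1).2
    rw [hga] at h2
    have : 0 < a * g t := lt_of_lt_of_le (by positivity) h2
    exact pos_of_mul_pos_right this ha0.le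
  have hSu : UniqueDiffOn ℝ S := by
    refine uniqueDiffOn_convex hSconv ⟨a, ?_⟩
    exact mem_interior_iff_mem_nhds.2 (hnhds a (hIab (left_mem_Icc.2 hab.le)))
  set G : ℕ → ℝ → ℝ := fun k => iteratedDerivWithin k g S with hG
  have hG0 : G 0 = g := iteratedDerivWithin_zero
  have hG1 : G 1 = derivWithin g S := iteratedDerivWithin_one
  have hGd : ∀ k < m, ∀ t ∈ I, HasDerivAt (G k) (G (k + 1) t) t := by
    intro k hk t ht
    have h1 := (hsm.differentiableOn_iteratedDerivWithin (m := k) (by exact_mod_cast hk) hSu) t (hIS ht)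
    have h2 := h1.hasDerivWithinAt.hasDerivAt (hnhds t ht)
    simp only [hG]
    rw [iteratedDerivWithin_succ]
    exact h2
  have hGc : ∀ k ≤ m, ContinuousOn (G k) I := fun k hk =>
    (hsm.continuousOn_iteratedDerivWithin (by exact_mod_cast hk) hSu).mono hIS
  have hgt : ∀ t ∈ I, G 0 t ≤ t * G 1 t := by
    intro t ht
    have hd := hGd 0 (by omega) t ht
    rw [hG0] at hd ⊢
    have := hgconv.slope_le_of_hasDerivAt (x := 0) ⟨le_rfl, by simpa using h0⟩ (hIS ht) ht.1 hd
    rw [slope_def_field, hg00, sub_zero, sub_zero, div_le_iff₀ ht.1] at this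
    linarith
  have hg0I : ∀ t ∈ I, 0 < G 0 t := fun t ht => by rw [hG0]; exact ht.2.2
  have hGb : ∀ k ≤ m, ∀ t ∈ I, |G k t| ≤ max 1 C₀ * (G 0 t * (G 1 t / G 0 t) ^ k) := by
    intro k hk t ht
    have h1 := hg0I t ht
    have h2 : 0 < G 1 t := by
      have h1' := hgt t ht
      have h3 := ht.1
      by_contra h
      nlinarith [not_lt.1 h]
    rcases k with _ | _ | k
    · rw [pow_zero, mul_one, abs_of_pos h1]
      nlinarith [le_max_left 1 C₀]
    · rw [zero_add, pow_one, abs_of_pos h2, mul_div_cancel₀ _ h1.ne']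
      nlinarith [le_max_left 1 C₀]
    · have h3 := htm (k + 2) (by omega) hk t (hIS ht)
      have h4 : G 0 t ^ (k + 1) * |G (k + 2) t| ≤ C₀ * G 1 t ^ (k + 2) := by
        rw [← abs_of_pos h1, ← abs_of_pos h2, hG0, hG1]
        exact h3
      have h5 : G 0 t ^ (k + 1) * |G (k + 2) t| ≤ max 1 C₀ * G 1 t ^ (k + 2) :=
        h4.trans (by gcongr; exact le_max_right _ _)
      have h6 : max 1 C₀ * (G 0 t * (G 1 t / G 0 t) ^ (k + 2)) =
          max 1 C₀ * G 1 t ^ (k + 2) / G 0 t ^ (k + 1) := by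
        rw [div_pow, pow_succ (G 0 t) (k + 1)]
        field_simp
      rw [h6, le_div_iff₀ (by positivity)]
      linarith
  have hosc := HK I G (fun k t => radialPow k ψ (t • v)) a b lam M hIo hIab hab
    (fun t ht => ht.1) hg0I hgt hGd hGc hGb hlam (by rw [hG0]; exact hga)
    (fun t ht => by
      rw [hG0]
      exact (hstar a t ha0.le ht.1 (ha0.trans_le ht.1) (hIab ht).2.1).2)
    hM (fun k hk => ((radialPow_cont hψ k hk).comp (by fun_prop)).continuousOn)
    (fun k hk t ht => hMb k hk _ ht.2.1)
    (fun k hk t ht => radialPow_ray hψ v k hk t ht.1)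
    (by
      filter_upwards [Ioi_mem_nhds hb0b] with t ht
      exact hb0 t ht)
  rw [hG0] at hosc
  -- assembling
  rw [integral_volumeIoiPow p (fun t => Complex.exp (Complex.I * ((lam * f (t • v) : ℝ) : ℂ)) *
                ((f (t • v) ^ ℓ * ψ (t • v) : ℝ) : ℂ))]
  set H : ℝ → ℂ := fun t => Complex.exp (Complex.I * ((lam * f (t • v) : ℝ) : ℂ)) *
                ((f (t • v) ^ ℓ * ψ (t • v) : ℝ) : ℂ) * ((t ^ p : ℝ) : ℂ) with hH
  have hint1 : ∫ t in Ioi (0 : ℝ), H t = ∫ t in (0 : ℝ)..b, H t := by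
    rw [intervalIntegral.integral_of_le hbpos.le]
    refine setIntegral_eq_of_subset_of_forall_sdiff_eq_zero measurableSet_Ioi
      Ioc_subset_Ioi_self ?_
    intro t ht
    have : b < t := by
      by_contra h
      exact ht.2 ⟨ht.1, not_lt.1 h⟩
    simp [hH, hb0 t (hb0b.trans this)]
  have hHc : ContinuousOn H (Icc 0 b) := by
    have h1 : ContinuousOn g (Icc 0 b) := hgcS.mono hsubS
    have h2 : Continuous fun t : ℝ => ψ (t • v) := hψ.continuous.comp (by fun_prop)
    refine ContinuousOn.mul (ContinuousOn.mul ?_ ?_) ?_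
    · exact (continuousOn_const.mul (Complex.continuous_ofReal.comp_continuousOn
        (continuousOn_const.mul h1))).cexp
    · exact Complex.continuous_ofReal.comp_continuousOn ((h1.pow _).mul h2.continuousOn)
    · exact (Complex.continuous_ofReal.comp (continuous_id.pow p)).continuousOn
  have hi1 : IntervalIntegrable H volume 0 a := by
    refine ContinuousOn.intervalIntegrable ?_
    rw [uIcc_of_le ha0.le]
    exact hHc.mono (Icc_subset_Icc_right hab.le)
  have hi2 : IntervalIntegrable H volume a b := by
    refine ContinuousOn.intervalIntegrable ?_
    rw [uIcc_of_le hab.le]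
    exact hHc.mono (Icc_subset_Icc_left ha0.le)
  have hp1 : ‖∫ t in (0 : ℝ)..a, H t‖ ≤ (|lam|⁻¹ ^ ℓ * M * a ^ p) * |a - 0| := by
    refine intervalIntegral.norm_integral_le_of_norm_le_const fun t ht => ?_
    rw [uIoc_of_le ha0.le] at ht
    obtain ⟨h1, h2⟩ := hstar t a ht.1.le ht.2 ha0 haΩ
    simp only [hH]
    rw [norm_mul, hnorm, Complex.norm_real, Real.norm_eq_abs, abs_pow, abs_of_pos ht.1]
    refine mul_le_mul (hsmall _ h1 ?_) (pow_le_pow_left₀ ht.1.le ht.2 _) (pow_nonneg ht.1.le _)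
      (by positivity)
    rw [abs_of_nonneg (hnn _ h1), ← hga]
    change g t ≤ g a
    have h3 : 0 ≤ g a := hga ▸ hc.le
    have h4 : a * g t ≤ a * g a := h2.trans (by gcongr; exact ht.2)
    exact le_of_mul_le_mul_left h4 ha0
  have hp2 : ‖∫ t in a..b, H t‖ ≤ K * M * (|lam|⁻¹ ^ ℓ * a ^ (p + 1)) := by
    refine le_trans (le_of_eq ?_) hosc
    congr 2
    ext t
    simp only [hH, hg, radialPow]
    push_cast
    ring
  have htot : ‖∫ t in Ioi (0 : ℝ), H t‖ ≤
      ((K + 1) * (p + 1) * M * |lam|⁻¹ ^ ℓ) * (a ^ (p + 1) / (p + 1)) := by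
    rw [hint1, ← intervalIntegral.integral_add_adjacent_intervals hi1 hi2]
    refine (norm_add_le _ _).trans ((add_le_add hp1 hp2).trans (le_of_eq ?_))
    rw [sub_zero, abs_of_pos ha0]
    field_simp
    ring
  rw [← ofReal_norm, ← ENNReal.ofReal_mul (by positivity)]
  exact ENNReal.ofReal_le_ofReal htot

theorem polar_bound_aux {E : Type*} [NormedAddCommGroup E] [NormedSpace ℝ E] [MeasureSpace E]
    [BorelSpace E] [FiniteDimensional ℝ E] [Nontrivial E] [(volume : Measure E).IsAddHaarMeasure]
    (p : ℕ) (hdim : Module.finrank ℝ E - 1 = p) (A : Set E) (hA : MeasurableSet A)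
    (F : E → ℂ) (c : ℝ≥0∞)
    (H : ∀ v : E, ‖v‖ = 1 →
      ‖∫ t : Ioi (0 : ℝ), F ((t : ℝ) • v) ∂(Measure.volumeIoiPow p)‖ₑ ≤
        c * Measure.volumeIoiPow p {t : Ioi (0 : ℝ) | (t : ℝ) • v ∈ A}) :
    ‖∫ x, F x‖ₑ ≤ c * volume A := by
  have hmp := (volume : Measure E).measurePreserving_homeomorphUnitSphereProd
  rw [hdim] at hmp
  have hsymm : ∀ x : ({0}ᶜ : Set E), ((homeomorphUnitSphereProd E x).2 : ℝ) •
      ((homeomorphUnitSphereProd E x).1 : E) = x := by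
    intro x
    have := (homeomorphUnitSphereProd E).symm_apply_apply x
    exact congrArg Subtype.val this
  have e1 : ∫ x, F x = ∫ z : sphere (0 : E) 1 × Ioi (0 : ℝ), F ((z.2 : ℝ) • (z.1 : E))
      ∂((volume : Measure E).toSphere.prod (Measure.volumeIoiPow p)) := by
    rw [← hmp.integral_comp (Homeomorph.measurableEmbedding _)]
    simp only [hsymm]
    rw [integral_subtype_comap (measurableSet_singleton _).compl F,
        restrict_compl_singleton]
  have hT : MeasurableSet {z : sphere (0 : E) 1 × Ioi (0 : ℝ) | (z.2 : ℝ) • (z.1 : E) ∈ A} := by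
    refine hA.preimage (Continuous.measurable ?_)
    fun_prop
  have e2 : ((volume : Measure E).toSphere.prod (Measure.volumeIoiPow p))
      {z : sphere (0 : E) 1 × Ioi (0 : ℝ) | (z.2 : ℝ) • (z.1 : E) ∈ A} ≤ volume A := by
    rw [← hmp.measure_preimage hT.nullMeasurableSet,
      comap_subtype_coe_apply (measurableSet_singleton _).compl]
    refine measure_mono ?_
    rintro _ ⟨x, hx, rfl⟩
    have : ((homeomorphUnitSphereProd E x).2 : ℝ) •
      ((homeomorphUnitSphereProd E x).1 : E) ∈ A := hx
    rwa [hsymm] at this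
  rw [e1]
  by_cases hint : Integrable (fun z : sphere (0 : E) 1 × Ioi (0 : ℝ) => F ((z.2 : ℝ) • (z.1 : E)))
      ((volume : Measure E).toSphere.prod (Measure.volumeIoiPow p))
  · rw [integral_prod _ hint]
    refine (enorm_integral_le_lintegral_enorm _).trans ?_
    refine le_trans (lintegral_mono fun v => H v (by simpa using v.2)) ?_
    have hmeas := measurable_measure_prodMk_left (ν := Measure.volumeIoiPow p) hT
    refine le_trans (le_of_eq ?_) (mul_le_mul_right e2 c)
    rw [Measure.prod_apply hT, ← lintegral_const_mul _ hmeas]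
    rfl
  · rw [integral_undef hint]
    simp

theorem polar_bound (p : ℕ) (A : Set (EuclideanSpace ℝ (Fin (p + 1)))) (hA : MeasurableSet A)
    (F : EuclideanSpace ℝ (Fin (p + 1)) → ℂ) (c : ℝ≥0∞)
    (H : ∀ v : EuclideanSpace ℝ (Fin (p + 1)), ‖v‖ = 1 →
      ‖∫ t : Ioi (0 : ℝ), F ((t : ℝ) • v) ∂(Measure.volumeIoiPow p)‖ₑ ≤
        c * Measure.volumeIoiPow p {t : Ioi (0 : ℝ) | (t : ℝ) • v ∈ A}) :
    ‖∫ x, F x‖ₑ ≤ c * volume A := by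
  exact polar_bound_aux p (by simp) A hA F c H

theorem statement_6 (d m ℓ : ℕ) (C₀ : ℝ) (hm : d + ℓ + 2 ≤ m) :
    ∃ C : ℝ≥0∞, 0 < C ∧ C < ⊤ ∧
      ∀ (Ω : Set (EuclideanSpace ℝ (Fin d))) (f : EuclideanSpace ℝ (Fin d) → ℝ),
        IsOpen Ω → Convex ℝ Ω → (0 : EuclideanSpace ℝ (Fin d)) ∈ Ω →
        ConvexOn ℝ Ω f → f 0 = 0 →
        HasFDerivAt f (0 : EuclideanSpace ℝ (Fin d) →L[ℝ] ℝ) 0 →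
        UniformlyRadiallyTame Ω f m C₀ →
        ∀ ψ : EuclideanSpace ℝ (Fin d) → ℝ,
          ContDiff ℝ (m : ℕ∞) ψ → HasCompactSupport ψ → tsupport ψ ⊆ Ω →
        ∀ lam : ℝ, lam ≠ 0 →
          ENNReal.ofReal
              ‖∫ x in Ω, Complex.exp (Complex.I * ((lam * f x : ℝ) : ℂ)) *
                ((f x ^ ℓ * ψ x : ℝ) : ℂ)‖ ≤
            C * ENNReal.ofReal (|lam|⁻¹ ^ ℓ) *
              volume {x ∈ Ω | |f x| < |lam|⁻¹} *
              ⨆ x ∈ Ω, ENNReal.ofReal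
                (∑ k ∈ Finset.range m, |radialPow k ψ x|) := by
  rcases d with _ | p
  · refine ⟨1, one_pos, ENNReal.one_lt_top, ?_⟩
    intro Ω f hΩ hΩc h0 hf hf0 hfd htame ψ hψ hψc hψΩ lam hlam
    have hx0 : ∀ x : EuclideanSpace ℝ (Fin 0), x = 0 := fun x => Subsingleton.elim _ _
    have hc : 0 < |lam|⁻¹ := inv_pos.2 (abs_pos.2 hlam)
    have hset : {x ∈ Ω | |f x| < |lam|⁻¹} = Ω := by
      ext x
      refine ⟨fun h => h.1, fun h => ⟨h, ?_⟩⟩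
      rw [hx0 x, hf0, abs_zero]; exact hc
    rw [hset, ofReal_norm]
    refine (enorm_integral_le_lintegral_enorm _).trans ?_
    set Sup := ⨆ x ∈ Ω, ENNReal.ofReal (∑ k ∈ Finset.range m, |radialPow k ψ x|) with hSup
    calc _ ≤ ∫⁻ x in Ω, ENNReal.ofReal (|lam|⁻¹ ^ ℓ) * Sup := by
          refine lintegral_mono fun x => ?_
          rw [← ofReal_norm, norm_mul, mul_comm Complex.I, Complex.norm_exp_ofReal_mul_I, one_mul,
            Complex.norm_real, Real.norm_eq_abs, abs_mul, abs_pow,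
            ENNReal.ofReal_mul (by positivity)]
          refine mul_le_mul' (ENNReal.ofReal_le_ofReal ?_) ?_
          · rw [hx0 x, hf0, abs_zero]
            exact pow_le_pow_left₀ le_rfl hc.le _
          · refine le_trans (ENNReal.ofReal_le_ofReal ?_)
              (le_iSup₂ (f := fun x (_ : x ∈ Ω) =>
                ENNReal.ofReal (∑ k ∈ Finset.range m, |radialPow k ψ x|)) x (hx0 x ▸ h0))
            exact Finset.single_le_sum (f := fun k => |radialPow k ψ x|)
              (fun k _ => abs_nonneg _) (Finset.mem_range.2 (show 0 < m by omega))
      _ = _ := by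
          rw [setLIntegral_const]; ring
  · obtain ⟨K, hK, HK⟩ := ray_bound p m ℓ C₀ hm
    refine ⟨ENNReal.ofReal (K + 1), by simp; positivity, ENNReal.ofReal_lt_top, ?_⟩
    intro Ω f hΩ hΩc h0 hf hf0 hfd htame ψ hψ hψc hψΩ lam hlam
    have hc : 0 < |lam|⁻¹ := inv_pos.2 (abs_pos.2 hlam)
    set Sup := ⨆ x ∈ Ω, ENNReal.ofReal (∑ k ∈ Finset.range m, |radialPow k ψ x|) with hSup
    have hfc : ContinuousOn f Ω := hf.continuousOn hΩ
    have hAo : IsOpen {x ∈ Ω | |f x| < |lam|⁻¹} :=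
      hfc.abs.isOpen_inter_preimage hΩ (isOpen_Iio (a := |lam|⁻¹))
    by_cases hS : Sup = ⊤
    · have hA0 : volume {x ∈ Ω | |f x| < |lam|⁻¹} ≠ 0 :=
        (hAo.measure_pos _ ⟨0, h0, by rw [hf0, abs_zero]; exact hc⟩).ne'
      rw [hS, ENNReal.mul_top]
      · exact le_top
      · refine mul_ne_zero (mul_ne_zero ?_ ?_) hA0
        · simp; positivity
        · simp; positivity
    have hbound : ∀ k < m, ∀ x ∈ Ω, |radialPow k ψ x| ≤ Sup.toReal := by
      intro k hk x hx
      rw [← ENNReal.ofReal_le_iff_le_toReal hS]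
      refine le_trans (ENNReal.ofReal_le_ofReal ?_)
              (le_iSup₂ (f := fun x (_ : x ∈ Ω) =>
                ENNReal.ofReal (∑ k ∈ Finset.range m, |radialPow k ψ x|)) x hx)
      exact Finset.single_le_sum (f := fun k => |radialPow k ψ x|)
              (fun k _ => abs_nonneg _) (Finset.mem_range.2 hk)
    have hray := HK (p + 1) Ω f hΩ hΩc h0 hf hf0 hfd htame ψ hψ hψc hψΩ lam hlam Sup.toReal
      ENNReal.toReal_nonneg hbound
    rw [setIntegral_eq_integral_of_forall_compl_eq_zero]
    · rw [ofReal_norm]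
      refine (polar_bound p _ hAo.measurableSet _ _ hray).trans ?_
      rw [ENNReal.ofReal_mul (by positivity), ENNReal.ofReal_mul hK, ENNReal.ofReal_toReal hS]
      calc _ = ENNReal.ofReal K * ENNReal.ofReal (|lam|⁻¹ ^ ℓ) *
            volume {x ∈ Ω | |f x| < |lam|⁻¹} * Sup := by ring
        _ ≤ _ := by
          gcongr
          linarith
    · intro x hx
      have : ψ x = 0 := by
        by_contra h
        exact hx (hψΩ (subset_tsupport _ h))
      simp [this]
end

section
/- For every α > 0 and every integer m ≥ 2, the function f(t) := e^{−(1 + α^{−1}) t^{−α}} for t ∈ (0,1], extended by f(0) = 0, is nonnegative, convex, and tame to order m on [0,1]: there exists a finite constant C (depending on α and m) such that for each k = 2,…,m and each t ∈ (0,1], |f(t)|^{k−1} |f^{(k)}(t)| ≤ C |f'(t)|^k. -/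
open Set

/-- The function `f(t) = e^{-(1+α⁻¹) t^{-α}}` for `t > 0`, extended by `0` for
`t ≤ 0`. -/
noncomputable def tameExample (α : ℝ) : ℝ → ℝ := fun t =>
  if t ≤ 0 then 0 else Real.exp (-(1 + α⁻¹) * t ^ (-α))

lemma tame_nonneg (α t : ℝ) : 0 ≤ tameExample α t := by
  unfold tameExample; split_ifs <;> positivity

lemma tame_of_pos (α : ℝ) {t : ℝ} (ht : 0 < t) :
    tameExample α t = Real.exp (-(1 + α⁻¹) * t ^ (-α)) := by
  simp [tameExample, not_le.2 ht]

lemma tame_u_deriv (α : ℝ) {t : ℝ} (ht : 0 < t) :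
    HasDerivAt (fun s : ℝ => s ^ (-α)) (-α * t ^ (-α) * t⁻¹) t := by
  have h := Real.hasDerivAt_rpow_const (x := t) (p := -α) (Or.inl ht.ne')
  rw [Real.rpow_sub_one ht.ne'] at h
  convert h using 1
  ring

lemma tame_hasDerivAt (α : ℝ) (hα : 0 < α) {t : ℝ} (ht : 0 < t) :
    HasDerivAt (tameExample α) (tameExample α t * ((α + 1) * t ^ (-α) * t⁻¹)) t := by
  have h := ((tame_u_deriv α ht).const_mul (-(1 + α⁻¹))).exp
  rw [tame_of_pos α ht]
  have h2 : HasDerivAt (fun s : ℝ => Real.exp (-(1 + α⁻¹) * s ^ (-α)))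
      (Real.exp (-(1 + α⁻¹) * t ^ (-α)) * ((α + 1) * t ^ (-α) * t⁻¹)) t := by
    convert h using 2
    field_simp
  refine h2.congr_of_eventuallyEq ?_
  filter_upwards [lt_mem_nhds ht] with s hs
  exact tame_of_pos α hs

lemma tame_step (α : ℝ) (hα : 0 < α) (k : ℕ) (P : Polynomial ℝ) {t : ℝ} (ht : 0 < t) :
    HasDerivAt (fun s => tameExample α s * (s⁻¹) ^ k * P.eval (s ^ (-α)))
      (tameExample α t * (t⁻¹) ^ (k + 1) *
        (Polynomial.C (α + 1) * (P * Polynomial.X) - Polynomial.C (k : ℝ) * P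
          - Polynomial.C α * (P.derivative * Polynomial.X)).eval (t ^ (-α))) t := by
  have h1 := tame_hasDerivAt α hα ht
  have h2 := (hasDerivAt_inv ht.ne').pow k
  have h3 := (P.hasDerivAt (t ^ (-α))).comp t (tame_u_deriv α ht)
  have h := (h1.mul h2).mul h3
  refine HasDerivAt.congr_deriv (f := (fun s => tameExample α s * (s⁻¹) ^ k * P.eval (s ^ (-α)))) h ?_
  simp only [Polynomial.eval_sub, Polynomial.eval_mul, Polynomial.eval_C, Polynomial.eval_X,
    Pi.mul_apply, Pi.pow_apply, Function.comp]
  rcases k with _ | k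
  · simp; ring
  · simp only [Nat.add_sub_cancel, pow_succ, pow_zero, one_mul, mul_inv]
    push_cast
    ring

lemma tame_iter (α : ℝ) (hα : 0 < α) (k : ℕ) : ∃ P : Polynomial ℝ, P.natDegree ≤ k ∧
    ∀ t : ℝ, 0 < t → iteratedDeriv k (tameExample α) t
      = tameExample α t * (t⁻¹) ^ k * P.eval (t ^ (-α)) := by
  induction k with
  | zero => exact ⟨1, by simp, by simp⟩
  | succ k ih =>
    obtain ⟨P, hP, h⟩ := ih
    refine ⟨Polynomial.C (α + 1) * (P * Polynomial.X) - Polynomial.C (k : ℝ) * P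
          - Polynomial.C α * (P.derivative * Polynomial.X), ?_, fun t ht => ?_⟩
    rotate_left
    · rw [iteratedDeriv_succ]
      refine HasDerivAt.deriv ((tame_step α hα k P ht).congr_of_eventuallyEq ?_)
      filter_upwards [lt_mem_nhds ht] with s hs
      exact h s hs
    · have hd : P.derivative.natDegree ≤ k := (Polynomial.natDegree_derivative_le P).trans (by omega)
      refine (Polynomial.natDegree_sub_le_of_le (m := max (k+1) (k+1)) (n := k+1)
        (Polynomial.natDegree_sub_le_of_le (m := k+1) (n := k+1) ?_ ?_) ?_).trans (by simp)
      · refine (Polynomial.natDegree_C_mul_le _ _).trans (Polynomial.natDegree_mul_le.trans ?_)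
        simp; omega
      · exact (Polynomial.natDegree_C_mul_le _ _).trans (by omega)
      · refine (Polynomial.natDegree_C_mul_le _ _).trans (Polynomial.natDegree_mul_le.trans ?_)
        simp only [Polynomial.natDegree_X]; omega

lemma tame_poly_bound (P : Polynomial ℝ) (k : ℕ) (hP : P.natDegree ≤ k) :
    ∃ A : ℝ, 0 ≤ A ∧ ∀ u : ℝ, 1 ≤ u → |P.eval u| ≤ A * u ^ k := by
  refine ⟨∑ i ∈ Finset.range (k + 1), |P.coeff i|, Finset.sum_nonneg fun _ _ => abs_nonneg _, ?_⟩
  intro u hu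
  rw [Polynomial.eval_eq_sum_range' (Nat.lt_succ_of_le hP), Finset.sum_mul]
  refine (Finset.abs_sum_le_sum_abs _ _).trans (Finset.sum_le_sum fun i hi => ?_)
  rw [abs_mul, abs_of_nonneg (pow_nonneg (by linarith : (0:ℝ) ≤ u) i)]
  have : i ≤ k := by simpa [Nat.lt_succ_iff] using hi
  gcongr

lemma tame_bound_k (α : ℝ) (hα : 0 < α) (k : ℕ) (hk : 1 ≤ k) : ∃ C : ℝ, 0 ≤ C ∧
    ∀ t ∈ Ioc (0 : ℝ) 1,
        |tameExample α t| ^ (k - 1) * |iteratedDeriv k (tameExample α) t| ≤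
          C * |deriv (tameExample α) t| ^ k := by
  obtain ⟨P, hP, h⟩ := tame_iter α hα k
  obtain ⟨A, hA, hb⟩ := tame_poly_bound P k hP
  refine ⟨A, hA, fun t ht => ?_⟩
  have ht0 := ht.1
  have hu : 1 ≤ t ^ (-α) := Real.one_le_rpow_of_pos_of_le_one_of_nonpos ht.1 ht.2 (by linarith)
  have hf := tame_nonneg α t
  rw [h t ht.1, (tame_hasDerivAt α hα ht.1).deriv]
  have hb' := hb _ hu
  set u := t ^ (-α)
  have hu0 : 0 ≤ u := by linarith
  rw [abs_mul, abs_of_nonneg hf, abs_of_nonneg (by positivity : 0 ≤ tameExample α t * t⁻¹ ^ k),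
    abs_of_nonneg (by positivity : 0 ≤ tameExample α t * ((α + 1) * u * t⁻¹))]
  set F := tameExample α t
  have e1 : F ^ (k - 1) * (F * t⁻¹ ^ k * |P.eval u|) = F ^ k * t⁻¹ ^ k * |P.eval u| := by
    obtain ⟨j, rfl⟩ : ∃ j, k = j + 1 := ⟨k - 1, by omega⟩
    simp only [Nat.add_sub_cancel]; ring
  rw [e1]
  have h1 : 1 ≤ (α + 1) ^ k := one_le_pow₀ (by linarith)
  calc F ^ k * t⁻¹ ^ k * |P.eval u| ≤ F ^ k * t⁻¹ ^ k * (A * u ^ k) := by gcongr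
    _ = A * (F ^ k * (1 * u ^ k * t⁻¹ ^ k)) := by ring
    _ ≤ A * (F ^ k * ((α + 1) ^ k * u ^ k * t⁻¹ ^ k)) := by gcongr
    _ = _ := by rw [mul_pow, mul_pow, mul_pow]

lemma tame_cont (α : ℝ) (hα : 0 < α) : ContinuousAt (tameExample α) 0 := by
  have h0 : tameExample α 0 = 0 := by simp [tameExample]
  have hc : ContinuousAt (fun t : ℝ => |t| ^ α) 0 :=
    (continuous_abs.rpow_const (fun _ => Or.inr hα.le)).continuousAt
  unfold ContinuousAt at *
  rw [h0]
  simp only [abs_zero, Real.zero_rpow hα.ne'] at hc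
  refine squeeze_zero (tame_nonneg α) (fun t => ?_) hc
  by_cases ht : t ≤ 0
  · simp only [tameExample, if_pos ht]; positivity
  · push Not at ht
    rw [tame_of_pos α ht, abs_of_pos ht, neg_mul, Real.exp_neg, Real.rpow_neg ht.le]
    have hp : 0 < t ^ α := Real.rpow_pos_of_pos ht α
    rw [inv_le_comm₀ (Real.exp_pos _) hp]
    have h1 := Real.add_one_le_exp ((1 + α⁻¹) * (t ^ α)⁻¹)
    have h2 : 0 < α⁻¹ * (t ^ α)⁻¹ := by positivity
    nlinarith

lemma tame_convex (α : ℝ) (hα : 0 < α) : ConvexOn ℝ (Icc (0 : ℝ) 1) (tameExample α) := by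
  have hstep : ∀ t : ℝ, 0 < t → HasDerivAt (deriv (tameExample α))
      (tameExample α t * (α + 1) ^ 2 * t⁻¹ ^ 2 * t ^ (-α) * (t ^ (-α) - 1)) t := by
    intro t ht
    have h := tame_step α hα 1 (Polynomial.C (α + 1) * Polynomial.X) ht
    refine HasDerivAt.congr_of_eventuallyEq (h.congr_deriv ?_) ?_
    · simp; ring
    · filter_upwards [lt_mem_nhds ht] with s hs
      rw [(tame_hasDerivAt α hα hs).deriv]
      simp; ring
  refine convexOn_of_deriv2_nonneg (convex_Icc 0 1) ?_ ?_ ?_ ?_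
  · intro t ht
    rcases ht.1.eq_or_lt with h | h
    · rw [← h]; exact (tame_cont α hα).continuousWithinAt
    · exact (tame_hasDerivAt α hα h).continuousAt.continuousWithinAt
  · rw [interior_Icc]
    exact fun t ht => (tame_hasDerivAt α hα ht.1).differentiableAt.differentiableWithinAt
  · rw [interior_Icc]
    exact fun t ht => (hstep t ht.1).differentiableAt.differentiableWithinAt
  · rw [interior_Icc]
    intro t ht
    have ht0 := ht.1
    have hu : 1 ≤ t ^ (-α) :=
      Real.one_le_rpow_of_pos_of_le_one_of_nonpos ht.1 ht.2.le (by linarith)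
    have hf := tame_nonneg α t
    have : deriv^[2] (tameExample α) t = _ := (hstep t ht.1).deriv
    rw [this]
    have h1 : 0 ≤ t ^ (-α) - 1 := by linarith
    positivity


/-- for every `α > 0` and every `m ≥ 2`, the function
`f(t) = e^{-(1+α⁻¹) t^{-α}}` on `(0,1]`, extended by `f(0) = 0`, is
nonnegative, convex on `[0,1]`, and tame to order `m` on `[0,1]`: there is a
finite `C` (depending on `α` and `m`) with
`|f(t)|^{k-1} |f^{(k)}(t)| ≤ C |f'(t)|^k` for all `2 ≤ k ≤ m`, `t ∈ (0,1]`. -/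
theorem statement_7 (α : ℝ) (hα : 0 < α) (m : ℕ) (hm : 2 ≤ m) :
    (∀ t : ℝ, 0 ≤ tameExample α t) ∧
    ConvexOn ℝ (Icc (0 : ℝ) 1) (tameExample α) ∧
    ∃ C : ℝ, 0 < C ∧
      ∀ k : ℕ, 2 ≤ k → k ≤ m → ∀ t ∈ Ioc (0 : ℝ) 1,
        |tameExample α t| ^ (k - 1) * |iteratedDeriv k (tameExample α) t| ≤
          C * |deriv (tameExample α) t| ^ k := by
  refine ⟨tame_nonneg α, tame_convex α hα, ?_⟩
  have H : ∀ k : ℕ, ∃ C : ℝ, 0 ≤ C ∧ (1 ≤ k → ∀ t ∈ Ioc (0 : ℝ) 1,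
        |tameExample α t| ^ (k - 1) * |iteratedDeriv k (tameExample α) t| ≤
          C * |deriv (tameExample α) t| ^ k) := by
    intro k
    by_cases hk : 1 ≤ k
    · obtain ⟨C, h0, h⟩ := tame_bound_k α hα k hk
      exact ⟨C, h0, fun _ => h⟩
    · exact ⟨0, le_rfl, fun h => absurd h hk⟩
  choose C hC0 hC using H
  have hs : 0 ≤ ∑ i ∈ Finset.range (m + 1), C i := Finset.sum_nonneg fun i _ => hC0 i
  refine ⟨1 + ∑ i ∈ Finset.range (m + 1), C i, by linarith, fun k hk hkm t ht => ?_⟩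
  refine (hC k (by omega) t ht).trans ?_
  have := Finset.single_le_sum (f := C) (s := Finset.range (m + 1)) (fun i _ => hC0 i)
    (Finset.mem_range.2 (Nat.lt_succ_of_le hkm))
  gcongr
  linarith
end

section
/- Let f : [0,T] → R be a convex polynomial function with f(0) = 0 and f'(0) = 0 (so f is nonnegative and nondecreasing on [0,T]). Then there is a constant C depending only on the degree of f such that for every t ∈ (0,T], f(t) ≤ t f'(t) ≤ C f(t). -/
open Set Polynomial

/-- for a convex polynomial `f` on `[0,T]` with `f(0) = 0` and
`f'(0) = 0` (hence `f` nonnegative and nondecreasing on `[0,T]`), there is a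
constant `C` depending only on the degree of `f` such that
`f(t) ≤ t f'(t) ≤ C f(t)` for all `t ∈ (0,T]`. -/
theorem statement_9 (D : ℕ) :
    ∃ C : ℝ, 0 < C ∧
      ∀ (p : Polynomial ℝ) (T : ℝ), 0 < T → p.natDegree ≤ D →
        p.eval 0 = 0 → p.derivative.eval 0 = 0 →
        (∀ t ∈ Icc (0 : ℝ) T, 0 ≤ (p.derivative.derivative).eval t) →
        ∀ t ∈ Ioc (0 : ℝ) T,
          p.eval t ≤ t * p.derivative.eval t ∧
          t * p.derivative.eval t ≤ C * p.eval t := by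
  set v : ℕ → ℝ := fun i => (i : ℝ) / (D + 1) with hv
  have hD : (0 : ℝ) < D + 1 := by positivity
  have hinj : Set.InjOn v (Finset.range (D + 1) : Finset ℕ) := by
    intro a _ b _ h
    simp only [hv] at h
    rw [div_left_inj' hD.ne'] at h
    exact_mod_cast h
  set s : Finset ℕ := Finset.range (D + 1) with hs
  refine ⟨1 + ∑ i ∈ s, |(derivative (Lagrange.basis s v i)).eval 1|, by positivity, ?_⟩
  intro p T hT hdeg h0 h0' hconv t ht
  have mono_of : ∀ q : Polynomial ℝ, (∀ x ∈ Icc (0 : ℝ) T, 0 ≤ (derivative q).eval x) →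
      MonotoneOn (fun x => q.eval x) (Icc 0 T) := by
    intro q hq
    apply monotoneOn_of_deriv_nonneg (convex_Icc 0 T) q.continuous.continuousOn
      q.differentiable.differentiableOn
    intro x hx
    rw [Polynomial.deriv]
    exact hq x (interior_subset hx)
  have h0T : (0 : ℝ) ∈ Icc 0 T := ⟨le_rfl, hT.le⟩
  have htT : t ∈ Icc 0 T := ⟨ht.1.le, ht.2⟩
  have m1 := mono_of _ hconv
  have hp' : ∀ x ∈ Icc (0 : ℝ) T, 0 ≤ (derivative p).eval x := by
    intro x hx
    have := m1 h0T hx hx.1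
    simpa [h0'] using this
  have m0 := mono_of p hp'
  have hpt : 0 ≤ p.eval t := by simpa [h0] using m0 h0T htT ht.1.le
  constructor
  · obtain ⟨c, hc, hce⟩ := exists_deriv_eq_slope (fun x => p.eval x) ht.1
      p.continuous.continuousOn p.differentiable.differentiableOn
    rw [Polynomial.deriv, h0, sub_zero, sub_zero, eq_div_iff ht.1.ne'] at hce
    have := m1 ⟨hc.1.le, hc.2.le.trans ht.2⟩ htT hc.2.le
    simp only at this
    have ht0 := ht.1
    nlinarith
  · set q : Polynomial ℝ := p.comp (C t * X) with hq
    have hqd : q.degree < s.card := by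
      rw [hs, Finset.card_range]
      refine lt_of_le_of_lt degree_le_natDegree ?_
      have : q.natDegree ≤ p.natDegree * (C t * X : ℝ[X]).natDegree := natDegree_comp_le
      have h2 : (C t * X : ℝ[X]).natDegree ≤ 1 := (natDegree_C_mul_le t X).trans natDegree_X_le
      have h3 : q.natDegree < D + 1 := by nlinarith
      exact_mod_cast h3
    have hint := Lagrange.eq_interpolate hinj hqd
    have hq1 : (derivative q).eval 1 = t * (derivative p).eval t := by
      simp [hq, derivative_comp]
    have hqi : ∀ i ∈ s, |q.eval (v i)| ≤ p.eval t := by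
      intro i hi
      have hi' : i < D + 1 := by simpa [hs] using hi
      have hi2 : (i : ℝ) ≤ D + 1 := by exact_mod_cast hi'.le
      have hv0 : 0 ≤ v i := by simp only [hv]; positivity
      have hv1 : v i ≤ 1 := by simp only [hv]; rw [div_le_one hD]; exact hi2
      have e : q.eval (v i) = p.eval (t * v i) := by simp [hq]
      have a0 : 0 ≤ t * v i := mul_nonneg ht.1.le hv0
      have a1 : t * v i ≤ t := mul_le_of_le_one_right ht.1.le hv1
      have aT : t * v i ∈ Icc 0 T := ⟨a0, a1.trans ht.2⟩
      have b0 : 0 ≤ p.eval (t * v i) := by simpa [h0] using m0 h0T aT a0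
      rw [e, abs_of_nonneg b0]
      exact m0 aT htT a1
    rw [← hq1, hint, Lagrange.interpolate_apply, derivative_sum, eval_finsetSum, add_mul, one_mul,
      Finset.sum_mul]
    have : ∑ i ∈ s, eval 1 (derivative (C (eval (v i) q) * Lagrange.basis s v i)) ≤
        ∑ i ∈ s, |(derivative (Lagrange.basis s v i)).eval 1| * p.eval t := by
      apply Finset.sum_le_sum
      intro i hi
      rw [derivative_C_mul, eval_C_mul]
      refine (le_abs_self _).trans ?_
      rw [abs_mul, mul_comm]
      exact mul_le_mul_of_nonneg_left (hqi i hi) (abs_nonneg _)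
    linarith
end

section
/- Suppose f ∈ C^2((0,T]) is positive, convex, and increasing on (0,T] (so f(t) > 0 and f'(t) > 0), and satisfies the order-2 tameness inequality f(t) f''(t) ≤ C (f'(t))^2 for all t ∈ (0,T]. Then the function t ↦ f(t)/(t f'(t)) satisfies | t · d/dt [ f(t)/(t f'(t)) ] | ≤ C for all t ∈ (0,T], and consequently for all t ∈ (0,T] and all ρ ≥ 1 with ρt ≤ T, | f(ρt)/(ρt f'(ρt)) − f(t)/(t f'(t)) | ≤ C ln ρ. -/
open Set

lemma mono_aux (T : ℝ) (g g' : ℝ → ℝ)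
    (h : ∀ t ∈ Ioc (0 : ℝ) T, HasDerivWithinAt g (g' t) (Ioc (0 : ℝ) T) t)
    (h0 : ∀ t ∈ Ioc (0 : ℝ) T, 0 ≤ g' t) : MonotoneOn g (Ioc (0 : ℝ) T) := by
  apply monotoneOn_of_hasDerivWithinAt_nonneg (convex_Ioc 0 T) (f' := g')
  · intro t ht
    exact (h t ht).continuousWithinAt
  · intro t ht
    exact (h t (interior_subset ht)).mono interior_subset
  · intro t ht
    exact h0 t (interior_subset ht)

/-- if `f ∈ C²((0,T])` is positive, increasing and convex on
`(0,T]`, satisfies the convexity consequence `f(t) ≤ t f'(t)` (so that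
`0 < f/(tf') ≤ 1`), and the order-2 tameness inequality
`f f'' ≤ C (f')²` on `(0,T]`, then `|t · d/dt[f(t)/(t f'(t))]| ≤ C` on
`(0,T]`, and consequently
`|f(ρt)/(ρt f'(ρt)) - f(t)/(t f'(t))| ≤ C ln ρ` whenever `t ∈ (0,T]`,
`ρ ≥ 1`, `ρ t ≤ T`. -/
theorem statement_15 (T C : ℝ) (hT : 0 < T) (hC : 0 < C) (f : ℝ → ℝ)
    (hreg : ContDiffOn ℝ (2 : ℕ∞) f (Ioc 0 T))
    (hpos : ∀ t ∈ Ioc (0 : ℝ) T, 0 < f t)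
    (hincr : ∀ t ∈ Ioc (0 : ℝ) T, 0 < derivWithin f (Ioc (0 : ℝ) T) t)
    (hconv : ∀ t ∈ Ioc (0 : ℝ) T,
      0 ≤ derivWithin (derivWithin f (Ioc (0 : ℝ) T)) (Ioc (0 : ℝ) T) t)
    (hsub : ∀ t ∈ Ioc (0 : ℝ) T, f t ≤ t * derivWithin f (Ioc (0 : ℝ) T) t)
    (htame : ∀ t ∈ Ioc (0 : ℝ) T,
      f t * derivWithin (derivWithin f (Ioc (0 : ℝ) T)) (Ioc (0 : ℝ) T) t ≤
        C * derivWithin f (Ioc (0 : ℝ) T) t ^ 2) :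
    (∀ t ∈ Ioc (0 : ℝ) T,
      |t * derivWithin
          (fun s => f s / (s * derivWithin f (Ioc (0 : ℝ) T) s))
          (Ioc (0 : ℝ) T) t| ≤ C) ∧
    (∀ t ∈ Ioc (0 : ℝ) T, ∀ ρ : ℝ, 1 ≤ ρ → ρ * t ≤ T →
      |f (ρ * t) / (ρ * t * derivWithin f (Ioc (0 : ℝ) T) (ρ * t)) -
          f t / (t * derivWithin f (Ioc (0 : ℝ) T) t)| ≤ C * Real.log ρ) := by
  have hu : UniqueDiffOn ℝ (Ioc (0 : ℝ) T) := uniqueDiffOn_Ioc 0 T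
  have hd1 : ∀ t ∈ Ioc (0 : ℝ) T,
      HasDerivWithinAt f (derivWithin f (Ioc (0 : ℝ) T) t) (Ioc (0 : ℝ) T) t := fun t ht =>
    ((hreg.differentiableOn (by norm_num)) t ht).hasDerivWithinAt
  have hreg1 : ContDiffOn ℝ 1 (derivWithin f (Ioc (0 : ℝ) T)) (Ioc (0 : ℝ) T) :=
    hreg.derivWithin hu (by norm_num)
  have hd2 : ∀ t ∈ Ioc (0 : ℝ) T,
      HasDerivWithinAt (derivWithin f (Ioc (0 : ℝ) T))
        (derivWithin (derivWithin f (Ioc (0 : ℝ) T)) (Ioc (0 : ℝ) T) t)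
        (Ioc (0 : ℝ) T) t := fun t ht =>
    ((hreg1.differentiableOn (by norm_num)) t ht).hasDerivWithinAt
  generalize derivWithin (derivWithin f (Ioc (0 : ℝ) T)) (Ioc (0 : ℝ) T) = f2 at *
  generalize derivWithin f (Ioc (0 : ℝ) T) = f1 at *
  have hq : ∀ t ∈ Ioc (0 : ℝ) T, f t * f2 t / f1 t ^ 2 ≤ C := fun t ht => by
    have := hincr t ht
    rw [div_le_iff₀ (by positivity)]
    exact htame t ht
  have hq0 : ∀ t ∈ Ioc (0 : ℝ) T, 0 ≤ f t * f2 t / f1 t ^ 2 := fun t ht => by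
    have := hincr t ht
    have := hpos t ht
    have := hconv t ht
    positivity
  have hm : MonotoneOn (fun s => f s / f1 s - (1 - C) * s) (Ioc (0 : ℝ) T) := by
    apply mono_aux T _ (fun t => (1 - f t * f2 t / f1 t ^ 2) - (1 - C) * 1)
    · intro t ht
      have h1 := hincr t ht
      have := ((hd1 t ht).div (hd2 t ht) h1.ne').sub
        ((hasDerivWithinAt_id t (Ioc (0 : ℝ) T)).const_mul (1 - C))
      refine this.congr_deriv ?_
      field_simp
    · intro t ht
      have := hq t ht
      linarith
  have hlow : ∀ t ∈ Ioc (0 : ℝ) T, (1 - C) * t ≤ f t / f1 t := by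
    intro t ht
    have hp : 0 < f t / f1 t := div_pos (hpos t ht) (hincr t ht)
    rcases le_or_gt 1 C with h | h
    · have := mul_nonneg (sub_nonneg.2 h) ht.1.le
      linarith
    · refine le_of_forall_pos_le_add fun e he => ?_
      have hs0 : 0 < min t (e / (1 - C)) := lt_min ht.1 (div_pos he (by linarith))
      have hst : min t (e / (1 - C)) ≤ t := min_le_left _ _
      have hse : min t (e / (1 - C)) ≤ e / (1 - C) := min_le_right _ _
      generalize min t (e / (1 - C)) = s at *
      have hs : s ∈ Ioc (0 : ℝ) T := ⟨hs0, hst.trans ht.2⟩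
      have h2 := hm hs ht hst
      have hp2 : 0 < f s / f1 s := div_pos (hpos s hs) (hincr s hs)
      rw [le_div_iff₀ (by linarith)] at hse
      simp only at h2
      linarith
  have hg : ∀ t ∈ Ioc (0 : ℝ) T, HasDerivWithinAt (fun s => f s / (s * f1 s))
      ((1 - f t * f2 t / f1 t ^ 2 - f t / (t * f1 t)) / t) (Ioc (0 : ℝ) T) t := by
    intro t ht
    have h1 := hincr t ht
    have h0 := ht.1
    have := (hd1 t ht).div ((hasDerivWithinAt_id t (Ioc (0 : ℝ) T)).mul (hd2 t ht))
      (mul_pos h0 h1).ne'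
    refine this.congr_deriv ?_
    simp only [id, Pi.mul_apply]
    field_simp
    ring
  have hb : ∀ t ∈ Ioc (0 : ℝ) T, |1 - f t * f2 t / f1 t ^ 2 - f t / (t * f1 t)| ≤ C := by
    intro t ht
    have h1 := hincr t ht
    have h0 := ht.1
    have a1 : f t / (t * f1 t) ≤ 1 := by
      rw [div_le_one (by positivity)]
      exact hsub t ht
    have a2 : 1 - C ≤ f t / (t * f1 t) := by
      have := hlow t ht
      rw [le_div_iff₀ h1] at this
      rw [le_div_iff₀ (by positivity)]
      linarith
    have := hq t ht
    have := hq0 t ht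
    rw [abs_le]
    constructor <;> linarith
  refine ⟨?_, ?_⟩
  · intro t ht
    rw [(hg t ht).derivWithin (hu t ht), mul_div_cancel₀ _ ht.1.ne']
    exact hb t ht
  · intro t ht ρ hρ hρT
    have hlog : ∀ s ∈ Ioc (0 : ℝ) T,
        HasDerivWithinAt (fun x => C * Real.log x) (C * s⁻¹) (Ioc (0 : ℝ) T) s :=
      fun s hs => ((Real.hasDerivAt_log hs.1.ne').const_mul C).hasDerivWithinAt
    have m1 := mono_aux T _ _ (fun s hs => (hlog s hs).sub (hg s hs)) (fun s hs => by
      rw [← div_eq_mul_inv, ← sub_div]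
      have := (abs_le.1 (hb s hs)).2
      exact div_nonneg (by linarith) hs.1.le)
    have m2 := mono_aux T _ _ (fun s hs => (hlog s hs).add (hg s hs)) (fun s hs => by
      rw [← div_eq_mul_inv, ← add_div]
      have := (abs_le.1 (hb s hs)).1
      exact div_nonneg (by linarith) hs.1.le)
    have hle : t ≤ ρ * t := le_mul_of_one_le_left ht.1.le hρ
    have hmem : ρ * t ∈ Ioc (0 : ℝ) T := ⟨ht.1.trans_le hle, hρT⟩
    have e1 := m1 ht hmem hle
    have e2 := m2 ht hmem hle
    simp only [Pi.sub_apply, Pi.add_apply] at e1 e2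
    rw [Real.log_mul (by linarith) ht.1.ne'] at e1 e2
    rw [abs_le]
    constructor <;> linarith
end
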